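/- Let F = FreeGroup X with X an infinite type, let R be a fully invariant subgroup of F contained in the commutator subgroup F' = ⁅F,F⁆ such that F/R is residually torsion-free nilpotent, let G = F ⧸ ⁅R,R⁆, and let R̂ be the image of R in G. Suppose σ ∈ Aut G satisfies: (a) the conjugacy class of σ is small (cardinality at most #X); (b) σ = τ_x ∘ γ where γ has small conjugacy class and fixes R̂ pointwise, and the image of x under the natural homomorphism G → F/R is a primitive element of the relatively free group F/R; and (c) the subgroup L(σ) of Aut G generated by the normal closure of σ in Aut G together with I_{G'} = {τ_c : c ∈ G'} contains no automorphism that has small conjugacy class, fixes R̂ pointwise, and is not of the form τ_r with r ∈ R̂. Then σ is an inner automorphism of G, L(σ) equals Inn G, and Inn G is a characteristic subgroup of Aut G (invariant under every automorphism of Aut G). -/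

import Mathlib

open Cardinal

/-- A group `H` is residually torsion-free nilpotent if every nonidentity element
survives in some torsion-free nilpotent quotient of `H`. -/
def ResiduallyTorsionFreeNilpotent (H : Type*) [Group H] : Prop :=
  ∀ h : H, h ≠ 1 → ∃ N : Subgroup H, ∃ hN : N.Normal,
    h ∉ N ∧
    (letI := hN;
      Group.IsNilpotent (H ⧸ N) ∧ ∀ g : H ⧸ N, g ≠ 1 → ∀ n : ℕ, n ≠ 0 → g ^ n ≠ 1)

/-- A subset `B` of a group `H` is a basis of `H` (as a relatively free group) if every
map `B → H` extends uniquely to an endomorphism of `H`. -/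
def IsBasis {H : Type*} [Group H] (B : Set H) : Prop :=
  ∀ f : B → H, ∃! φ : H →* H, ∀ b : B, φ b = f b

/-- An element of a group is primitive if it belongs to some basis. -/
def IsPrimitiveElement {H : Type*} [Group H] (p : H) : Prop :=
  ∃ B : Set H, IsBasis B ∧ p ∈ B

/-- The natural homomorphism `F/R' → F/R`. -/
def natHom {X : Type*} (R : Subgroup (FreeGroup X)) [R.Normal] :
    (FreeGroup X ⧸ ⁅R, R⁆) →* FreeGroup X ⧸ R :=
  QuotientGroup.map ⁅R, R⁆ R (MonoidHom.id (FreeGroup X))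
    (Subgroup.commutator_le_left R R)

/-- A family `x` is a relative basis of `Γ` if it generates `Γ` and every map from the index set
to `Γ` is induced by an endomorphism of `Γ`. -/
structure IsRelBasis {X Γ : Type*} [Group Γ] (x : X → Γ) : Prop where
  exists_endo : ∀ f : X → Γ, ∃ φ : Γ →* Γ, ∀ i, φ (x i) = f i
  closure_eq : Subgroup.closure (Set.range x) = ⊤

namespace IsRelBasis

section Basic

variable {X Γ : Type*} [Group Γ] {x : X → Γ} (hx : IsRelBasis x)

/-- The endomorphism with prescribed values on a relative basis. -/
noncomputable def endo (f : X → Γ) : Γ →* Γ := (hx.exists_endo f).choose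

@[simp] lemma endo_apply (f : X → Γ) (i : X) : hx.endo f (x i) = f i :=
  (hx.exists_endo f).choose_spec i

lemma hom_ext (hx : IsRelBasis x) {M : Type*} [Monoid M] {φ ψ : Γ →* M}
    (h : ∀ i, φ (x i) = ψ (x i)) : φ = ψ :=
  MonoidHom.eq_of_eqOn_dense hx.closure_eq (by rintro _ ⟨i, rfl⟩; exact h i)

lemma hom_congr (hx : IsRelBasis x) {M : Type*} [Monoid M] {φ ψ : Γ →* M}
    (h : ∀ i, φ (x i) = ψ (x i)) (g : Γ) : φ g = ψ g := by rw [hx.hom_ext h]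

lemma aut_ext (hx : IsRelBasis x) {φ ψ : MulAut Γ} (h : ∀ i, φ (x i) = ψ (x i)) : φ = ψ := by
  ext g
  exact hx.hom_congr (φ := φ.toMonoidHom) (ψ := ψ.toMonoidHom) h g

lemma generators_induction (hx : IsRelBasis x) {p : Γ → Prop} (hX : ∀ i, p (x i)) (h1 : p 1)
    (hmul : ∀ g h, p g → p h → p (g * h)) (hinv : ∀ g, p g → p g⁻¹) (g : Γ) : p g := by
  have hg : g ∈ Subgroup.closure (Set.range x) := by rw [hx.closure_eq]; trivial
  induction hg using Subgroup.closure_induction with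
  | mem y hy => obtain ⟨i, rfl⟩ := hy; exact hX i
  | one => exact h1
  | mul a b _ _ ha hb => exact hmul a b ha hb
  | inv a _ ha => exact hinv a ha

open Classical in
/-- Substitute `g` for the letter `x t`. -/
noncomputable def sub (t : X) (g : Γ) : Γ →* Γ := hx.endo (Function.update x t g)

@[simp] lemma sub_self (t : X) (g : Γ) : hx.sub t g (x t) = g := by simp [sub]

lemma sub_of_ne {t s : X} (h : s ≠ t) (g : Γ) : hx.sub t g (x s) = x s := by simp [sub, h]

/-- The letter `x t` does not occur in `g`. -/
def Fresh (t : X) (g : Γ) : Prop := hx.sub t 1 g = g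

variable {hx}

lemma Fresh.mul {t : X} {g h : Γ} (hg : hx.Fresh t g) (hh : hx.Fresh t h) :
    hx.Fresh t (g * h) := by
  unfold Fresh at *; rw [map_mul, hg, hh]

lemma Fresh.inv {t : X} {g : Γ} (hg : hx.Fresh t g) : hx.Fresh t g⁻¹ := by
  unfold Fresh at *; rw [map_inv, hg]

variable (hx)

lemma fresh_one (t : X) : hx.Fresh t 1 := map_one _

lemma fresh_letter {t s : X} (h : s ≠ t) : hx.Fresh t (x s) := hx.sub_of_ne h 1

lemma sub_sub_one (t : X) (h g : Γ) : hx.sub t h (hx.sub t 1 g) = hx.sub t 1 g := by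
  refine hx.hom_congr (φ := (hx.sub t h).comp (hx.sub t 1)) (fun i => ?_) g
  by_cases hi : i = t
  · subst hi; simp
  · simp [hx.sub_of_ne hi]

lemma sub_fresh {t : X} {g : Γ} (hg : hx.Fresh t g) (h : Γ) : hx.sub t h g = g := by
  have := hx.sub_sub_one t h g
  rwa [show hx.sub t 1 g = g from hg] at this

lemma eventually_fresh (g : Γ) : ∀ᶠ t in Filter.cofinite, hx.Fresh t g := by
  refine hx.generators_induction (p := fun g => ∀ᶠ t in Filter.cofinite, hx.Fresh t g)
    (fun i => ?_) ?_ (fun g h hg hh => ?_) (fun g hg => ?_) g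
  · filter_upwards [(Set.finite_singleton i).compl_mem_cofinite] with t ht
    exact hx.fresh_letter (by simpa [eq_comm] using ht)
  · exact Filter.Eventually.of_forall hx.fresh_one
  · filter_upwards [hg, hh] with t h1 h2 using h1.mul h2
  · filter_upwards [hg] with t h1 using h1.inv

end Basic

section Auts

variable {X Γ : Type*} [Group Γ] {x : X → Γ} (hx : IsRelBasis x)

/-- The endomorphism multiplying each letter `x i` by `u i` on the left. -/
noncomputable def lmul (u : X → Γ) : Γ →* Γ := hx.endo fun i => u i * x i

@[simp] lemma lmul_apply (u : X → Γ) (i : X) : hx.lmul u (x i) = u i * x i := hx.endo_apply _ i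

/-- The automorphism multiplying each letter `x i` by `u i` on the left, when both multiplication
by `u` and by `u⁻¹` fix all the `u i`. -/
noncomputable def lmulAut (u : X → Γ) (h : ∀ i, hx.lmul u (u i) = u i)
    (h' : ∀ i, hx.lmul u⁻¹ (u i) = u i) : MulAut Γ :=
  MonoidHom.toMulEquiv (hx.lmul u) (hx.lmul u⁻¹)
    (hx.hom_ext fun i => by simp [h'])
    (hx.hom_ext fun i => by simp [h])

lemma lmulAut_apply {u : X → Γ} (h : ∀ i, hx.lmul u (u i) = u i)
    (h' : ∀ i, hx.lmul u⁻¹ (u i) = u i) (i : X) : hx.lmulAut u h h' (x i) = u i * x i :=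
  hx.lmul_apply u i

lemma lmulAut_inv_apply {u : X → Γ} (h : ∀ i, hx.lmul u (u i) = u i)
    (h' : ∀ i, hx.lmul u⁻¹ (u i) = u i) (i : X) :
    (hx.lmulAut u h h')⁻¹ (x i) = (u i)⁻¹ * x i :=
  hx.lmul_apply u⁻¹ i

open Classical in
/-- The map `x i ↦ x (φ i) * x i` for `i ∈ S`, fixing the other letters. -/
noncomputable def mulOn (S : Set X) (φ : X → X) (h : ∀ i ∈ S, φ i ∉ S) : MulAut Γ :=
  hx.lmulAut (fun i => if i ∈ S then x (φ i) else 1)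
    (fun i => by by_cases hi : i ∈ S <;> simp [hi, h])
    (fun i => by by_cases hi : i ∈ S <;> simp [hi, h])

variable {S : Set X} {φ : X → X} (h : ∀ i ∈ S, φ i ∉ S)

lemma mulOn_mem {i : X} (hi : i ∈ S) : hx.mulOn S φ h (x i) = x (φ i) * x i := by
  rw [mulOn, lmulAut_apply, if_pos hi]

lemma mulOn_notMem {i : X} (hi : i ∉ S) : hx.mulOn S φ h (x i) = x i := by
  rw [mulOn, lmulAut_apply, if_neg hi, one_mul]

lemma mulOn_symm_mem {i : X} (hi : i ∈ S) : (hx.mulOn S φ h).symm (x i) = (x (φ i))⁻¹ * x i := by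
  rw [← MulAut.inv_def, mulOn, lmulAut_inv_apply, if_pos hi]

lemma mulOn_symm_notMem {i : X} (hi : i ∉ S) : (hx.mulOn S φ h).symm (x i) = x i := by
  rw [← MulAut.inv_def, mulOn, lmulAut_inv_apply, if_neg hi, inv_one, one_mul]

/-- The transvection `x b ↦ x s * x b`. -/
noncomputable def transv (b s : X) (h : s ≠ b) : MulAut Γ :=
  hx.mulOn {b} (fun _ => s) (by simpa using h)

lemma transv_self {b s : X} (h : s ≠ b) : hx.transv b s h (x b) = x s * x b :=
  hx.mulOn_mem _ rfl

lemma transv_of_ne {b s k : X} (h : s ≠ b) (hk : k ≠ b) : hx.transv b s h (x k) = x k :=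
  hx.mulOn_notMem _ hk

end Auts

section Small

universe u

/-- If the conjugacy class of `π` has fewer elements than the index set of a family `g` of group
elements, two of the conjugates of `π` by members of `g` agree. -/
lemma exists_ne_commute {A : Type u} [Group A] {π : A} {ι : Type u}
    (hι : #{τ : A | IsConj π τ} < #ι) (g : ι → A) :
    ∃ i j, i ≠ j ∧ Commute π ((g j)⁻¹ * g i) := by
  have hF : ¬ Function.Injective
      (fun i => (⟨g i * π * (g i)⁻¹, isConj_iff.2 ⟨g i, rfl⟩⟩ : {τ : A | IsConj π τ})) :=
    fun hinj => absurd hι (not_lt.2 (Cardinal.mk_le_of_injective hinj))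
  simp only [Function.Injective, not_forall] at hF
  obtain ⟨i, j, hij, hne⟩ := hF
  refine ⟨i, j, hne, ?_⟩
  have h2 : g i * π * (g i)⁻¹ = g j * π * (g j)⁻¹ := by simpa using hij
  unfold Commute SemiconjBy
  calc π * ((g j)⁻¹ * g i) = (g j)⁻¹ * (g j * π * (g j)⁻¹) * g i := by group
    _ = _ := by rw [← h2]; group

variable {κ J Γ : Type u} [Group Γ]

/-- Multiplications by a fixed letter `q` over subsets of `A` that move different letters and
whose quotient commutes with `π`. -/
lemma exists_commute_mulOn {x : J → Γ} (hx : IsRelBasis x) {π : MulAut Γ} {A : Set J} {q : J}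
    (hπ : #{τ : MulAut Γ | IsConj π τ} ≤ #A) (hq : q ∉ A) :
    ∃ (T T' : Set J) (hT : ∀ i ∈ T, (fun _ => q) i ∉ T) (hT' : ∀ i ∈ T', (fun _ => q) i ∉ T'),
      T ⊆ A ∧ T' ⊆ A ∧ (∃ a ∈ T, a ∉ T') ∧
      Commute π ((hx.mulOn T' (fun _ => q) hT')⁻¹ * hx.mulOn T (fun _ => q) hT) := by
  have hsub : ∀ t : Set A, Subtype.val '' t ⊆ A := by rintro t _ ⟨y, _, rfl⟩; exact y.2
  have hd : ∀ t : Set A, ∀ i ∈ Subtype.val '' t, (fun _ => q) i ∉ Subtype.val '' t :=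
    fun t i _ h => hq (hsub t h)
  obtain ⟨t, t', hne, hc⟩ := exists_ne_commute (π := π) (ι := Set A)
    (hπ.trans_lt (by rw [Cardinal.mk_set]; exact Cardinal.cantor _))
    (fun t => hx.mulOn (Subtype.val '' t) (fun _ => q) (hd t))
  have hcases : (∃ a ∈ t, a ∉ t') ∨ (∃ a ∈ t', a ∉ t) := by
    by_contra! hcon
    exact hne (Set.Subset.antisymm hcon.1 hcon.2)
  have himg : ∀ (t t' : Set A), (∃ a ∈ t, a ∉ t') →
      ∃ a ∈ Subtype.val '' t, a ∉ (Subtype.val '' t' : Set J) := by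
    rintro t t' ⟨a, ha, ha'⟩
    exact ⟨a, ⟨a, ha, rfl⟩, by simpa using ha'⟩
  rcases hcases with h | h
  · exact ⟨_, _, hd t, hd t', hsub t, hsub t', himg _ _ h, hc⟩
  · refine ⟨_, _, hd t', hd t, hsub t', hsub t, himg _ _ h, ?_⟩
    have := hc.inv_right
    rwa [mul_inv_rev, inv_inv] at this

lemma transv_eq_commutator {x : J → Γ} (hx : IsRelBasis x) {T T' : Set J} {q a b : J}
    (hT : ∀ i ∈ T, (fun _ => q) i ∉ T) (hT' : ∀ i ∈ T', (fun _ => q) i ∉ T')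
    (hqT : q ∉ T) (hqT' : q ∉ T') (hbT : b ∉ T) (hbT' : b ∉ T') (haT : a ∈ T) (haT' : a ∉ T')
    (hqb : q ≠ b) {L : MulAut Γ} (hLb : L (x b) = x a * x b) (hLq : L (x q) = x q)
    (hL : ∀ k, k ≠ b → L (x k) = x k ∨
      ((hx.mulOn T' (fun _ => q) hT')⁻¹ * hx.mulOn T (fun _ => q) hT) (x k) = x k ∧
      ((hx.mulOn T' (fun _ => q) hT')⁻¹ * hx.mulOn T (fun _ => q) hT) (L (x k)) = L (x k)) :
    L⁻¹ * ((hx.mulOn T' (fun _ => q) hT')⁻¹ * hx.mulOn T (fun _ => q) hT) * L *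
      ((hx.mulOn T' (fun _ => q) hT')⁻¹ * hx.mulOn T (fun _ => q) hT)⁻¹ = hx.transv b q hqb := by
  set E := hx.mulOn T (fun _ => q) hT with hE
  set E' := hx.mulOn T' (fun _ => q) hT' with hE'
  set c := E'⁻¹ * E with hc
  have Lsymm : ∀ y z, L y = z → L⁻¹ z = y := by rintro y _ rfl; simp
  have csymm : ∀ y z, c y = z → c⁻¹ z = y := by rintro y _ rfl; simp
  have hcb : c (x b) = x b := by
    simp [hc, hE, hE', MulAut.mul_apply, mulOn_notMem, mulOn_symm_notMem, hbT, hbT']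
  have hca : c (x a) = x q * x a := by
    simp [hc, hE, hE', MulAut.mul_apply, mulOn_mem, mulOn_symm_notMem, haT, haT', hqT']
  refine hx.aut_ext fun k => ?_
  by_cases hk : k = b
  · subst hk
    rw [transv_self]
    simp only [MulAut.mul_apply]
    rw [csymm _ _ hcb, hLb, map_mul, hca, hcb, mul_assoc, map_mul, Lsymm _ _ hLq,
      Lsymm _ _ hLb]
  · rw [hx.transv_of_ne _ hk]
    change L⁻¹ (c (L (c⁻¹ (x k)))) = x k
    rcases hL k hk with h | ⟨h1, h2⟩
    · have hfix : L (c⁻¹ (x k)) = c⁻¹ (x k) := by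
        have : c⁻¹ (x k) = E⁻¹ (E' (x k)) := by simp [hc, MulAut.mul_apply]
        rw [this]
        by_cases h3 : k ∈ T' <;> by_cases h4 : k ∈ T <;>
          simp [hE, hE', mulOn_mem, mulOn_notMem, mulOn_symm_mem, mulOn_symm_notMem, h3, h4, h,
            hLq, hqT]
      rw [hfix, MulAut.apply_inv_self, Lsymm _ _ h]
    · rw [csymm _ _ h1, h2]
      simp

end Small
section Small

universe u

variable {κ Γ : Type u} [Group Γ]

/-- The set of moved letters for the diagonal automorphism given by `χ`. -/
def diagSet (χ : κ → κ × κ) : Set (κ × κ) := {p | p.2 = (χ p.1).2 ∧ (χ p.1).1 ≠ (χ p.1).2}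

lemma diagSet_disjoint (χ : κ → κ × κ) :
    ∀ p ∈ diagSet χ, (fun p : κ × κ => (p.1, (χ p.1).1)) p ∉ diagSet χ := by
  rintro p ⟨_, h2⟩ ⟨h3, _⟩
  exact h2 h3

/-- Some block `i` is good: all the maps `x (i, b) ↦ x (i, a) * x (i, b)` extend to automorphisms
commuting with `π` which fix the other letters of the block and respect the other blocks. -/
lemma exists_good_block {x : κ × κ → Γ} (hx : IsRelBasis x) {π : MulAut Γ}
    (hπ : #{τ : MulAut Γ | IsConj π τ} ≤ #κ) :
    ∃ i : κ, ∀ a b : κ, a ≠ b → ∃ L : MulAut Γ, Commute π L ∧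
      L (x (i, b)) = x (i, a) * x (i, b) ∧ (∀ y, y ≠ b → L (x (i, y)) = x (i, y)) ∧
      ∀ j, j ≠ i → ∀ y, L (x (j, y)) ∈ Subgroup.closure (Set.range fun z => x (j, z)) := by
  classical
  let D : (κ → κ × κ) → MulAut Γ := fun χ => hx.mulOn (diagSet χ) _ (diagSet_disjoint χ)
  have : Nonempty {τ : MulAut Γ | IsConj π τ} := ⟨⟨π, IsConj.refl π⟩⟩
  obtain ⟨e⟩ := Cardinal.le_def _ _ |>.1 hπ
  obtain ⟨F, hF⟩ : ∃ F : κ → {τ : MulAut Γ | IsConj π τ}, Function.Surjective F :=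
    ⟨_, Function.invFun_surjective e.injective⟩
  have key : ∃ i : κ, ∀ p : κ × κ, ∃ χ : κ → κ × κ, χ i = p ∧
      D χ * π * (D χ)⁻¹ = F i := by
    by_contra! hcon
    choose p hp using hcon
    obtain ⟨i, hi⟩ := hF ⟨D p * π * (D p)⁻¹, isConj_iff.2 ⟨D p, rfl⟩⟩
    exact hp i p rfl (by rw [hi])
  obtain ⟨i, hi⟩ := key
  refine ⟨i, fun a b hab => ?_⟩
  obtain ⟨χ, hχ, h1⟩ := hi (a, b)
  obtain ⟨χ', hχ', h2⟩ := hi (b, b)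
  rw [← h2] at h1
  have hnot : ∀ y, (i, y) ∉ diagSet χ' := by
    rintro y ⟨_, h⟩
    simp [hχ'] at h
  refine ⟨(D χ')⁻¹ * D χ, ?_, ?_, fun y hy => ?_, fun j _ y => ?_⟩
  · unfold Commute SemiconjBy
    calc π * ((D χ')⁻¹ * D χ) = (D χ')⁻¹ * (D χ' * π * (D χ')⁻¹) * D χ := by group
      _ = _ := by rw [← h1]; group
  · have hm : (i, b) ∈ diagSet χ := by simp [diagSet, hχ, hab]
    simp [D, mulOn_mem, hm, mulOn_symm_notMem, hnot, hχ]
  · have hm : (i, y) ∉ diagSet χ := by simp [diagSet, hχ, hy]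
    simp [D, mulOn_notMem, hm, mulOn_symm_notMem, hnot]
  · have hl : ∀ z, x (j, z) ∈ Subgroup.closure (Set.range fun z => x (j, z)) :=
      fun z => Subgroup.subset_closure ⟨z, rfl⟩
    have hs : ∀ z, (D χ').symm (x (j, z)) ∈ Subgroup.closure (Set.range fun z => x (j, z)) := by
      intro z
      by_cases hz : (j, z) ∈ diagSet χ'
      · simp only [D, mulOn_symm_mem _ _ hz]
        exact mul_mem (inv_mem (hl _)) (hl _)
      · simp only [D, mulOn_symm_notMem _ _ hz]
        exact hl _
    by_cases hz : (j, y) ∈ diagSet χ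
    · simp only [D, MulAut.mul_apply, mulOn_mem _ _ hz, map_mul, MulAut.inv_def]
      exact mul_mem (hs _) (hs _)
    · simp only [D, MulAut.mul_apply, mulOn_notMem _ _ hz, MulAut.inv_def]
      exact hs _

lemma mk_block_compl [Infinite κ] (i : κ) (q b : κ × κ) :
    #κ ≤ #{p : κ × κ | p.1 = i ∧ p ≠ q ∧ p ≠ b} := by
  have h1 : #({q.2, b.2}ᶜ : Set κ) = #κ :=
    Cardinal.mk_compl_of_infinite _ ((Cardinal.lt_aleph0_of_finite _).trans_le
      (Cardinal.aleph0_le_mk κ))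
  rw [← h1]
  refine Cardinal.mk_le_of_injective
    (f := fun y => ⟨(i, y.1), rfl, fun h => y.2 ?_, fun h => y.2 ?_⟩) ?_
  · simp [← h]
  · simp [← h]
  · intro y z h
    simpa [Subtype.ext_iff] using h

/-- An automorphism with small conjugacy class commutes with all transvections that move a letter
from a suitable block. -/
lemma exists_commute_transv [Infinite κ] {x : κ × κ → Γ} (hx : IsRelBasis x) {π : MulAut Γ}
    (hπ : #{τ : MulAut Γ | IsConj π τ} ≤ #κ) :
    ∃ i : κ, ∀ (b : κ) (s : κ × κ) (h : s ≠ (i, b)), Commute π (hx.transv (i, b) s h) := by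
  obtain ⟨i, hi⟩ := hx.exists_good_block hπ
  have hblock : ∀ (b y : κ) (h : (i, y) ≠ (i, b)), Commute π (hx.transv (i, b) (i, y) h) := by
    intro b y h
    obtain ⟨T, T', hT, hT', hTA, hTA', ⟨a, ha, ha'⟩, hc⟩ :=
      hx.exists_commute_mulOn (hπ.trans (mk_block_compl i (i, y) (i, b))) (q := (i, y))
        (by simp)
    obtain ⟨a1, a2⟩ := a
    obtain rfl : a1 = i := (hTA ha).1
    have hab : a2 ≠ b := fun h => (hTA ha).2.2 (by rw [h])
    have hyb : y ≠ b := fun h' => h (by rw [h'])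
    obtain ⟨L, hL1, hL2, hL3, hL4⟩ := hi a2 b hab
    rw [← hx.transv_eq_commutator hT hT' (fun h => (hTA h).2.1 rfl) (fun h => (hTA' h).2.1 rfl)
      (fun h => (hTA h).2.2 rfl) (fun h => (hTA' h).2.2 rfl) ha ha' h hL2 (hL3 y hyb) ?_]
    · exact ((hL1.inv_right.mul_right hc).mul_right hL1).mul_right hc.inv_right
    · rintro ⟨j, k⟩ hk
      by_cases hj : j = a1
      · subst hj
        exact Or.inl (hL3 k fun h => hk (by rw [h]))
      · refine Or.inr ?_
        set c := (hx.mulOn T' (fun _ => (a1, y)) hT')⁻¹ * hx.mulOn T (fun _ => (a1, y)) hT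
        have hfix : ∀ z, c (x (j, z)) = x (j, z) := by
          intro z
          have h1 : (j, z) ∉ T := fun h => hj (hTA h).1
          have h2 : (j, z) ∉ T' := fun h => hj (hTA' h).1
          simp [c, mulOn_notMem, h1, mulOn_symm_notMem, h2]
        refine ⟨hfix k, ?_⟩
        have hle : Subgroup.closure (Set.range fun z => x (j, z)) ≤
            (MonoidHom.eqLocus c.toMonoidHom (MonoidHom.id Γ)) := by
          rw [Subgroup.closure_le]
          rintro _ ⟨z, rfl⟩
          exact hfix z
        exact hle (hL4 j hj k)
  refine ⟨i, fun b s h => ?_⟩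
  obtain ⟨T, T', hT, hT', hTA, hTA', ⟨a, ha, ha'⟩, hc⟩ :=
    hx.exists_commute_mulOn (hπ.trans (mk_block_compl i s (i, b))) (q := s) (by simp)
  obtain ⟨a1, a2⟩ := a
  obtain rfl : a1 = i := (hTA ha).1
  have hab : (a1, a2) ≠ (a1, b) := (hTA ha).2.2
  have hL1 := hblock b a2 hab
  rw [← hx.transv_eq_commutator hT hT' (fun h => (hTA h).2.1 rfl) (fun h => (hTA' h).2.1 rfl)
    (fun h => (hTA h).2.2 rfl) (fun h => (hTA' h).2.2 rfl) ha ha' h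
    (hx.transv_self hab) (hx.transv_of_ne hab h) fun k hk => Or.inl (hx.transv_of_ne hab hk)]
  exact ((hL1.inv_right.mul_right hc).mul_right hL1).mul_right hc.inv_right

end Small
section Word

variable {J Γ : Type*} [Group Γ] {x : J → Γ} (hx : IsRelBasis x)

variable {hx} in
lemma Fresh.hom_congr {M : Type*} [Monoid M] {φ ψ : Γ →* M} {t : J} {w : Γ} (hw : hx.Fresh t w)
    (h : ∀ i, i ≠ t → φ (x i) = ψ (x i)) : φ w = ψ w := by
  rw [← show hx.sub t 1 w = w from hw]
  refine hx.hom_congr (φ := φ.comp (hx.sub t 1)) (ψ := ψ.comp (hx.sub t 1)) (fun i => ?_) w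
  by_cases hi : i = t
  · subst hi; simp
  · simp [hx.sub_of_ne hi, h i hi]

lemma exists_fresh [Infinite J] (S : Set J) (hS : S.Finite) (g : Γ) :
    ∃ t, t ∉ S ∧ hx.Fresh t g := by
  have h : ∀ᶠ t in Filter.cofinite, t ∉ S := hS.compl_mem_cofinite
  exact (h.and (hx.eventually_fresh g)).exists

variable {π : MulAut Γ} {β : J} (hβ : ∀ s (h : s ≠ β), Commute π (hx.transv β s h))
include hβ

lemma transv_apply_comm (s : J) (h : s ≠ β) (g : Γ) :
    hx.transv β s h (π g) = π (hx.transv β s h g) :=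
  (DFunLike.congr_fun (hβ s h) g).symm

lemma fresh_of_commute_transv [Infinite J] {s : J} (hs : s ≠ β) : hx.Fresh β (π (x s)) := by
  obtain ⟨t, ht, hf⟩ := hx.exists_fresh {β} (Set.finite_singleton β) (π (x s))
  have htβ : t ≠ β := by simpa using ht
  have h1 : hx.transv β t htβ (π (x s)) = π (x s) := by
    rw [hx.transv_apply_comm hβ, hx.transv_of_ne htβ hs]
  have h2 := hf.hom_congr (φ := ((hx.sub t (x β)).comp (hx.sub β 1)).comp
    (hx.transv β t htβ).toMonoidHom) (ψ := MonoidHom.id Γ) (fun i hi => by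
      by_cases hiβ : i = β
      · subst hiβ
        simp [transv_self, hx.sub_of_ne htβ]
      · simp [hx.transv_of_ne htβ hiβ, hx.sub_of_ne hiβ, hx.sub_of_ne hi])
  have h3 := hf.hom_congr (φ := (hx.sub t (x β)).comp (hx.sub β 1)) (ψ := hx.sub β 1)
    (fun i hi => by
      by_cases hiβ : i = β
      · subst hiβ; simp
      · simp [hx.sub_of_ne hiβ, hx.sub_of_ne hi])
  have h4 : (hx.sub t (x β)) (hx.sub β 1 (hx.transv β t htβ (π (x s)))) = π (x s) := h2
  rw [h1] at h4
  exact (h3.symm.trans h4 : _)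

lemma map_mul_of_commute_transv {s : J} (hs : s ≠ β) :
    π (x s) * π (x β) = hx.transv β s hs (π (x β)) := by
  rw [hx.transv_apply_comm hβ, transv_self, map_mul]

lemma transv_eq_sub {s : J} (hs : s ≠ β) (g : Γ) :
    hx.transv β s hs g = hx.sub β (x s * x β) g := by
  refine hx.hom_congr (φ := (hx.transv β s hs).toMonoidHom) (fun i => ?_) g
  by_cases hi : i = β
  · subst hi; simp [transv_self]
  · simp [hx.transv_of_ne hs hi, hx.sub_of_ne hi]

omit hβ in
/-- An automorphism commuting with all transvections at two letters is given by substitution into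
a single word. -/
lemma exists_word_of_commute_transv [Infinite J] {b b' : J} (hbb : b ≠ b')
    (hb : ∀ s (h : s ≠ b), Commute π (hx.transv b s h))
    (hb' : ∀ s (h : s ≠ b'), Commute π (hx.transv b' s h)) :
    ∃ w, ∀ g, π g = hx.sub b g w := by
  have F3 : hx.sub b 1 (π (x b)) = 1 := by
    have h1 := congrArg (hx.sub b 1) (hx.map_mul_of_commute_transv hb' hbb)
    have hf : hx.Fresh b (π (x b')) := hx.fresh_of_commute_transv hb hbb.symm
    have h2 : hx.sub b 1 (hx.transv b' b hbb (π (x b'))) = π (x b') :=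
      hf.hom_congr (φ := (hx.sub b 1).comp (hx.transv b' b hbb).toMonoidHom)
        (ψ := MonoidHom.id Γ) (fun i hi => by
        by_cases hib : i = b'
        · subst hib; simp [transv_self, hx.sub_of_ne hi]
        · simp [hx.transv_of_ne hbb hib, hx.sub_of_ne hi])
    rw [h2, map_mul, show hx.sub b 1 (π (x b')) = π (x b') from hf] at h1
    simpa using h1
  have F4 : ∀ s, π (x s) = hx.sub b (x s) (π (x b)) := by
    intro s
    by_cases hs : s = b
    · subst hs
      refine (hx.hom_congr (φ := hx.sub s (x s)) (ψ := MonoidHom.id Γ) (fun i => ?_) _).symm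
      by_cases hi : i = s
      · subst hi; simp
      · simp [hx.sub_of_ne hi]
    · have h1 := congrArg (hx.sub b 1) (hx.map_mul_of_commute_transv hb hs)
      rw [map_mul, F3, mul_one, show hx.sub b 1 (π (x s)) = π (x s) from
        hx.fresh_of_commute_transv hb hs] at h1
      rw [h1]
      refine hx.hom_congr (φ := (hx.sub b 1).comp (hx.transv b s hs).toMonoidHom) (fun i => ?_) _
      by_cases hi : i = b
      · subst hi; simp [transv_self, hx.sub_of_ne hs]
      · simp [hx.transv_of_ne hs hi, hx.sub_of_ne hi]
  refine ⟨π (x b), ?_⟩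
  set w := π (x b) with hw
  obtain ⟨s, hs, hf⟩ := hx.exists_fresh {b} (Set.finite_singleton b) w
  have hsb : s ≠ b := by simpa using hs
  have h0 : hx.sub b (x s) w * hx.sub b (x b) w = hx.sub b (x s * x b) w := by
    rw [← F4 s, ← F4 b, hx.map_mul_of_commute_transv hb hsb, hx.transv_eq_sub hb]
  have hmul : ∀ g h, hx.sub b (g * h) w = hx.sub b g w * hx.sub b h w := by
    classical
    intro g h
    set χ := hx.endo (Function.update (Function.update x b h) s g) with hχ
    have hχs : χ (x s) = g := by simp [hχ]
    have hχb : χ (x b) = h := by simp [hχ, hsb.symm]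
    have hcomp : ∀ y, χ (hx.sub b y w) = hx.sub b (χ y) w := fun y =>
      hf.hom_congr (φ := χ.comp (hx.sub b y)) (ψ := hx.sub b (χ y)) (fun i hi => by
        by_cases hib : i = b
        · subst hib; simp
        · simp [hx.sub_of_ne hib, hχ, hib, hi])
    have h1 := congrArg χ h0
    rw [map_mul, hcomp, hcomp, hcomp, map_mul, hχs, hχb] at h1
    exact h1.symm
  exact hx.hom_congr (φ := π.toMonoidHom) (ψ := MonoidHom.mk' (fun g => hx.sub b g w) hmul) F4

end Word

universe u

variable {X Γ : Type u} [Group Γ]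

lemma comp_equiv {Y : Type*} {x : X → Γ} (hx : IsRelBasis x) (e : Y ≃ X) :
    IsRelBasis (x ∘ e) where
  exists_endo f := ⟨hx.endo (f ∘ e.symm), fun i => by simp⟩
  closure_eq := by rw [e.surjective.range_comp]; exact hx.closure_eq

/-- An automorphism with small conjugacy class acts by substitution into a single word. -/
theorem exists_word_of_small [Infinite X] {x : X → Γ} (hx : IsRelBasis x) {π : MulAut Γ}
    (hπ : #{τ : MulAut Γ | IsConj π τ} ≤ #X) : ∃ b w, ∀ g, π g = hx.sub b g w := by
  obtain ⟨e⟩ : Nonempty (X × X ≃ X) := by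
    rw [← Cardinal.eq, Cardinal.mk_prod, Cardinal.lift_id,
      Cardinal.mul_eq_self (Cardinal.aleph0_le_mk X)]
  have hy := hx.comp_equiv e
  obtain ⟨i, hi⟩ := hy.exists_commute_transv hπ
  obtain ⟨b, b', hbb⟩ := exists_pair_ne X
  obtain ⟨w, hw⟩ := hy.exists_word_of_commute_transv (b := (i, b)) (b' := (i, b'))
    (by simpa using hbb) (hi b) (hi b')
  refine ⟨e (i, b), w, fun g => ?_⟩
  rw [hw g]
  refine hy.hom_congr (fun p => ?_) w
  by_cases hp : p = (i, b)
  · subst hp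
    rw [hy.sub_self, Function.comp_apply, sub_self]
  · rw [hy.sub_of_ne hp, Function.comp_apply, hx.sub_of_ne (by simpa using hp)]

/-- For an automorphism with small conjugacy class, the image of a general letter is a word
describing the automorphism. -/
theorem eventually_sub_apply_of_small [Infinite X] {x : X → Γ} (hx : IsRelBasis x) {π : MulAut Γ}
    (hπ : #{τ : MulAut Γ | IsConj π τ} ≤ #X) :
    ∀ᶠ t in Filter.cofinite, ∀ g, hx.sub t g (π (x t)) = π g := by
  obtain ⟨b, w, hw⟩ := hx.exists_word_of_small hπ
  filter_upwards [hx.eventually_fresh w] with t ht g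
  rw [hw, hw]
  refine ht.hom_congr (φ := (hx.sub t g).comp (hx.sub b (x t))) (fun i hi => ?_)
  by_cases hib : i = b
  · subst hib; simp
  · simp [hx.sub_of_ne hib, hx.sub_of_ne hi]

end IsRelBasis

namespace MonoidAlgebra

variable {H A : Type*} [Group H] [AddCommGroup A]

/-- The additive map from the integral group ring with prescribed values on group elements. -/
noncomputable def intLift (a : H → A) : MonoidAlgebra ℤ H →+ A :=
  (Finsupp.liftAddHom fun h => zmultiplesHom A (a h)).comp coeffAddEquiv.toAddMonoidHom

@[simp] lemma intLift_of (a : H → A) (h : H) : intLift a (of ℤ H h) = a h := by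
  simp [intLift, of, coeffAddEquiv]

lemma int_addHom_ext {f g : MonoidAlgebra ℤ H →+ A} (h : ∀ m, f (of ℤ H m) = g (of ℤ H m)) :
    f = g := by
  refine addMonoidHom_ext fun m r => ?_
  have hr : (single m r : MonoidAlgebra ℤ H) = r • of ℤ H m := by simp [of]
  rw [hr, map_zsmul, map_zsmul, h]

lemma int_finsupp_addHom_ext {X : Type*} {f g : (X →₀ MonoidAlgebra ℤ H) →+ A}
    (h : ∀ i m, f (Finsupp.single i (of ℤ H m)) = g (Finsupp.single i (of ℤ H m))) : f = g := by
  refine Finsupp.addHom_ext' fun i => int_addHom_ext fun m => ?_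
  exact h i m

end MonoidAlgebra

open MonoidAlgebra

/-- A Fox derivation `D` along a surjection `ν : G → H`: a crossed homomorphism to the free
`ℤ[H]`-module on the letters sending letters to the corresponding basis vectors. -/
structure IsFoxDerivation {X G H : Type*} [Group G] [Group H] (ν : G →* H) (x : X → G)
    (D : G → X →₀ MonoidAlgebra ℤ H) : Prop where
  map_mul : ∀ g h, D (g * h) = D g + of ℤ H (ν g) • D h
  map_letter : ∀ i, D (x i) = Finsupp.single i 1

namespace IsFoxDerivation

variable {X G H : Type*} [Group G] [Group H] {ν : G →* H} {x : X → G}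
  {D : G → X →₀ MonoidAlgebra ℤ H} (hD : IsFoxDerivation ν x D)
include hD

lemma map_one : D 1 = 0 := by
  have := hD.map_mul 1 1
  simpa [-of_apply] using this

lemma map_inv (g : G) : D g⁻¹ = - (of ℤ H (ν g)⁻¹ • D g) := by
  have h := hD.map_mul g⁻¹ g
  rw [inv_mul_cancel, hD.map_one, _root_.map_inv] at h
  exact eq_neg_of_add_eq_zero_left h.symm

/-- The augmentation-type boundary map sending the basis vector at `i` to `x i - 1`. -/
noncomputable def _root_.foxBoundary (y : X → H) :
    (X →₀ MonoidAlgebra ℤ H) →ₗ[MonoidAlgebra ℤ H] MonoidAlgebra ℤ H :=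
  Finsupp.linearCombination _ fun i => of ℤ H (y i) - 1

omit hD in
lemma _root_.foxBoundary_single (y : X → H) (i : X) (a : MonoidAlgebra ℤ H) :
    foxBoundary y (Finsupp.single i a) = a * (of ℤ H (y i) - 1) := by
  simp [foxBoundary]

lemma boundary (hx : Subgroup.closure (Set.range x) = ⊤) (g : G) :
    foxBoundary (ν ∘ x) (D g) = of ℤ H (ν g) - 1 := by
  have hg : g ∈ Subgroup.closure (Set.range x) := by rw [hx]; trivial
  induction hg using Subgroup.closure_induction with
  | mem y hy => obtain ⟨i, rfl⟩ := hy; simp [hD.map_letter, foxBoundary_single, -of_apply]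
  | one => simp [hD.map_one, one_def]
  | mul a b _ _ ha hb =>
    rw [hD.map_mul, map_add, map_smul, ha, hb, smul_eq_mul, mul_sub, ← _root_.map_mul, mul_one,
      ← _root_.map_mul]
    abel
  | inv a _ ha =>
    rw [hD.map_inv, map_neg, map_smul, ha, smul_eq_mul, mul_sub, ← _root_.map_mul, inv_mul_cancel,
      _root_.map_one, mul_one, _root_.map_inv ν, neg_sub]

/-- For an abelian kernel, a Fox derivation is injective on the kernel and identifies it with the
kernel of the boundary map. -/
lemma ker_exact (hx : Subgroup.closure (Set.range x) = ⊤) (hν : Function.Surjective ν)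
    (hab : ∀ a ∈ ν.ker, ∀ b ∈ ν.ker, a * b = b * a) :
    (∀ g, D g = 0 → g = 1) ∧
      ∀ p, foxBoundary (ν ∘ x) p = 0 → ∃ ρ ∈ ν.ker, D ρ = p := by
  let _ : CommGroup ν.ker :=
    { (inferInstance : Group ν.ker) with
      mul_comm := fun a b => Subtype.ext (hab a a.2 b b.2) }
  choose τ hτ using hν
  have hmem : ∀ h w, τ h * w * (τ (h * ν w))⁻¹ ∈ ν.ker := by
    intro h w
    simp [MonoidHom.mem_ker, hτ]
  let κ : H → G → Additive ν.ker := fun h w => Additive.ofMul ⟨_, hmem h w⟩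
  have hκmul : ∀ h w w', κ h (w * w') = κ h w + κ (h * ν w) w' := by
    intro h w w'
    refine Additive.toMul.injective (Subtype.ext ?_)
    change τ h * (w * w') * (τ (h * ν (w * w')))⁻¹ = τ h * w * (τ (h * ν w))⁻¹ *
      (τ (h * ν w) * w' * (τ (h * ν w * ν w'))⁻¹)
    rw [_root_.map_mul, ← mul_assoc h]
    group
  have hκone : ∀ h, κ h 1 = 0 := by
    intro h
    have := hκmul h 1 1
    simpa using this
  let Φ : (X →₀ MonoidAlgebra ℤ H) →+ Additive ν.ker :=
    Finsupp.liftAddHom fun i => intLift fun h => κ h (x i)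
  have hΦsingle : ∀ h i, Φ (Finsupp.single i (of ℤ H h)) = κ h (x i) := by
    intro h i
    simp only [Φ, Finsupp.liftAddHom_apply_single, intLift_of]
  have hΦD : ∀ w h, Φ (of ℤ H h • D w) = κ h w := by
    intro w
    have hg : w ∈ Subgroup.closure (Set.range x) := by rw [hx]; trivial
    induction hg using Subgroup.closure_induction with
    | mem y hy =>
      obtain ⟨i, rfl⟩ := hy
      intro h
      rw [hD.map_letter, Finsupp.smul_single, smul_eq_mul, mul_one, hΦsingle]
    | one => intro h; rw [hD.map_one, smul_zero, map_zero, hκone]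
    | mul a b _ _ ha hb =>
      intro h
      rw [hD.map_mul, smul_add, map_add, ha, smul_smul, ← _root_.map_mul, hb, hκmul]
    | inv a _ ha =>
      intro h
      have h1 := hκmul (h * ν a⁻¹) a a⁻¹
      have h2 := hκmul h a⁻¹ a
      rw [inv_mul_cancel, hκone] at h2
      rw [hD.map_inv, smul_neg, smul_smul, ← _root_.map_mul, map_neg, ← _root_.map_inv, ha]
      exact (eq_neg_of_add_eq_zero_left h2.symm).symm
  have hinjK : ∀ g ∈ ν.ker, D g = 0 → g = 1 := by
    intro g hg h0
    have h1 := hΦD g 1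
    rw [h0, smul_zero, map_zero] at h1
    have h2 : τ 1 * g * (τ (1 * ν g))⁻¹ = 1 :=
      (congrArg (fun a : Additive ν.ker => ((Additive.toMul a : ν.ker) : G)) h1).symm
    rw [show ν g = 1 from hg, mul_one] at h2
    simpa using mul_inv_eq_one.1 h2
  refine ⟨fun g h0 => hinjK g ?_ h0, fun p hp => ?_⟩
  · have h1 := hD.boundary hx g
    rw [h0, map_zero, eq_comm, sub_eq_zero, ← _root_.map_one (of ℤ H)] at h1
    exact of_injective h1
  · let DK : Additive ν.ker →+ (X →₀ MonoidAlgebra ℤ H) :=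
      { toFun := fun a => D ((Additive.toMul a : ν.ker) : G)
        map_zero' := hD.map_one
        map_add' := fun a b => by
          have ha : ν ((Additive.toMul a : ν.ker) : G) = 1 := (Additive.toMul a : ν.ker).2
          rw [toMul_add, Subgroup.coe_mul, hD.map_mul, ha, _root_.map_one, one_smul] }
    have hDK : ∀ h w, DK (κ h w) = D (τ h) + of ℤ H h • D w - D (τ (h * ν w)) := by
      intro h w
      change D (τ h * w * (τ (h * ν w))⁻¹) = _
      rw [hD.map_mul, hD.map_mul, hD.map_inv, _root_.map_mul, hτ, hτ, smul_neg, smul_smul,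
        ← _root_.map_mul, mul_inv_cancel, _root_.map_one, one_smul]
      abel
    have hcomp : DK.comp Φ = AddMonoidHom.id _ -
        (intLift fun h => D (τ h)).comp (foxBoundary (ν ∘ x)).toAddMonoidHom := by
      refine int_finsupp_addHom_ext fun i m => ?_
      simp only [AddMonoidHom.comp_apply, AddMonoidHom.sub_apply, AddMonoidHom.id_apply,
        LinearMap.toAddMonoidHom_coe]
      rw [hΦsingle, hDK, foxBoundary_single, mul_sub, mul_one, map_sub, ← _root_.map_mul,
        intLift_of, intLift_of, hD.map_letter, Finsupp.smul_single, smul_eq_mul, mul_one]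
      simp only [Function.comp_apply]
      abel
    refine ⟨(Additive.toMul (Φ p) : ν.ker), (Additive.toMul (Φ p) : ν.ker).2, ?_⟩
    have h1 := DFunLike.congr_fun hcomp p
    simp only [AddMonoidHom.comp_apply, AddMonoidHom.sub_apply, AddMonoidHom.id_apply,
        LinearMap.toAddMonoidHom_coe, hp, map_zero, sub_zero] at h1
    exact h1

end IsFoxDerivation

namespace MonoidAlgebra

variable (X H : Type*) [Group H]

/-- The action of `H` on the free `ℤ[H]`-module on `X` by scalar multiplication. -/
noncomputable def freeModuleAction : H →* MulAut (Multiplicative (X →₀ MonoidAlgebra ℤ H)) where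
  toFun h :=
    { toFun := fun p => Multiplicative.ofAdd (of ℤ H h • p.toAdd)
      invFun := fun p => Multiplicative.ofAdd (of ℤ H h⁻¹ • p.toAdd)
      left_inv := fun p => by
        simp only [toAdd_ofAdd, smul_smul, ← map_mul, inv_mul_cancel, map_one, one_smul,
          ofAdd_toAdd]
      right_inv := fun p => by
        simp only [toAdd_ofAdd, smul_smul, ← map_mul, mul_inv_cancel, map_one, one_smul,
          ofAdd_toAdd]
      map_mul' := fun p q => by simp only [toAdd_mul, smul_add, ofAdd_add] }
  map_one' := by
    ext1 p
    simp only [MulEquiv.coe_mk, Equiv.coe_fn_mk, map_one, one_smul, ofAdd_toAdd, MulAut.one_apply]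
  map_mul' g h := by
    ext1 p
    simp only [MulEquiv.coe_mk, Equiv.coe_fn_mk, map_mul, mul_smul, MulAut.mul_apply,
      toAdd_ofAdd]

end MonoidAlgebra

section Quotients

variable {X : Type*} (R : Subgroup (FreeGroup X)) [R.Normal]

/-- The image of the letter `i` in `F/R'`. -/
def letter (i : X) : FreeGroup X ⧸ ⁅R, R⁆ := QuotientGroup.mk (FreeGroup.of i)

lemma natHom_mk (w : FreeGroup X) : natHom R (QuotientGroup.mk w) = QuotientGroup.mk w := rfl

lemma natHom_surjective : Function.Surjective (natHom R) := by
  intro h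
  obtain ⟨w, rfl⟩ := QuotientGroup.mk_surjective h
  exact ⟨QuotientGroup.mk w, rfl⟩

lemma ker_natHom : (natHom R).ker = R.map (QuotientGroup.mk' ⁅R, R⁆) := by
  ext g
  obtain ⟨w, rfl⟩ := QuotientGroup.mk_surjective g
  rw [MonoidHom.mem_ker, natHom_mk, QuotientGroup.eq_one_iff]
  refine ⟨fun h => ⟨w, h, rfl⟩, ?_⟩
  rintro ⟨v, hv, hvw⟩
  have h1 : v⁻¹ * w ∈ ⁅R, R⁆ := QuotientGroup.eq.1 hvw
  simpa using R.mul_mem hv (Subgroup.commutator_le_left R R h1)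

lemma ker_natHom_comm : ∀ a ∈ (natHom R).ker, ∀ b ∈ (natHom R).ker, a * b = b * a := by
  rw [ker_natHom]
  rintro _ ⟨a, ha, rfl⟩ _ ⟨b, hb, rfl⟩
  rw [← map_mul, ← map_mul]
  refine QuotientGroup.eq.2 ?_
  have := Subgroup.commutator_mem_commutator (R.inv_mem hb) (R.inv_mem ha)
  rw [commutatorElement_def] at this
  convert this using 1
  group

lemma exists_isFoxDerivation :
    ∃ D, IsFoxDerivation (natHom R) (letter R) D := by
  let Ψ : FreeGroup X →*
      Multiplicative (X →₀ MonoidAlgebra ℤ (FreeGroup X ⧸ R)) ⋊[freeModuleAction X _]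
        (FreeGroup X ⧸ R) :=
    FreeGroup.lift fun i => ⟨Multiplicative.ofAdd (Finsupp.single i 1),
      QuotientGroup.mk (FreeGroup.of i)⟩
  have hright : ∀ w, (Ψ w).right = QuotientGroup.mk w := by
    intro w
    have : SemidirectProduct.rightHom.comp Ψ = QuotientGroup.mk' R := by
      ext i
      simp [Ψ]
    exact DFunLike.congr_fun this w
  have hker : ⁅R, R⁆ ≤ Ψ.ker := by
    rw [Subgroup.commutator_le]
    intro a ha b hb
    rw [MonoidHom.mem_ker, map_commutatorElement, commutatorElement_eq_one_iff_mul_comm]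
    have ha' : (Ψ a).right = 1 := by rw [hright]; exact (QuotientGroup.eq_one_iff a).2 ha
    have hb' : (Ψ b).right = 1 := by rw [hright]; exact (QuotientGroup.eq_one_iff b).2 hb
    ext1
    · simp [ha', hb', mul_comm]
    · simp [ha', hb']
  let Ψ' := QuotientGroup.lift ⁅R, R⁆ Ψ hker
  have hright' : ∀ g, (Ψ' g).right = natHom R g := by
    intro g
    obtain ⟨w, rfl⟩ := QuotientGroup.mk_surjective g
    exact hright w
  refine ⟨fun g => (Ψ' g).left.toAdd, ⟨fun g h => ?_, fun i => ?_⟩⟩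
  · rw [map_mul, SemidirectProduct.mul_left, toAdd_mul, hright']
    rfl
  · change (Ψ (FreeGroup.of i)).left.toAdd = _
    simp [Ψ]

variable {R}

lemma isRelBasis_quotient (N : Subgroup (FreeGroup X)) [N.Normal]
    (hN : ∀ f : FreeGroup X →* FreeGroup X, N.map f ≤ N) :
    IsRelBasis fun i : X => (QuotientGroup.mk (FreeGroup.of i) : FreeGroup X ⧸ N) where
  exists_endo f := by
    choose v hv using fun i => QuotientGroup.mk_surjective (f i)
    refine ⟨QuotientGroup.map N N (FreeGroup.lift v) (Subgroup.map_le_iff_le_comap.1 (hN _)),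
      fun i => ?_⟩
    rw [QuotientGroup.map_mk, FreeGroup.lift_apply_of, hv]
  closure_eq := by
    have h1 := FreeGroup.closure_range_of X
    have h2 := congrArg (Subgroup.map (QuotientGroup.mk' N)) h1
    rw [MonoidHom.map_closure, ← Set.range_comp, ← MonoidHom.range_eq_map,
      MonoidHom.range_eq_top.2 (QuotientGroup.mk'_surjective N)] at h2
    exact h2

lemma isRelBasis_letter (hR : ∀ f : FreeGroup X →* FreeGroup X, R.map f ≤ R) :
    IsRelBasis (letter R) := by
  refine isRelBasis_quotient ⁅R, R⁆ fun f => ?_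
  rw [Subgroup.map_commutator]
  exact Subgroup.commutator_mono (hR f) (hR f)

lemma isRelBasis_natHom_letter (hR : ∀ f : FreeGroup X →* FreeGroup X, R.map f ≤ R) :
    IsRelBasis (natHom R ∘ letter R) :=
  isRelBasis_quotient R hR

open Classical in
lemma exists_degree (hRF' : R ≤ commutator (FreeGroup X)) (f : X → ℤ) :
    ∃ δ : FreeGroup X ⧸ R →* Multiplicative ℤ,
      ∀ i, δ ((natHom R ∘ letter R) i) = Multiplicative.ofAdd (f i) := by
  refine ⟨QuotientGroup.lift R (FreeGroup.lift fun i => Multiplicative.ofAdd (f i))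
    (hRF'.trans (Abelianization.commutator_subset_ker _)), fun i => ?_⟩
  change (FreeGroup.lift fun i => Multiplicative.ofAdd (f i)) (FreeGroup.of i) = _
  simp

lemma ResiduallyTorsionFreeNilpotent.eq_one_of_pow_eq_one {H : Type*} [Group H]
    (hH : ResiduallyTorsionFreeNilpotent H) {h : H} {n : ℕ} (hn : n ≠ 0) (h1 : h ^ n = 1) :
    h = 1 := by
  by_contra hne
  obtain ⟨N, hN, hmem, -, htf⟩ := hH h hne
  refine htf (QuotientGroup.mk h) (fun h2 => hmem ((QuotientGroup.eq_one_iff h).1 h2)) n hn ?_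
  rw [← QuotientGroup.mk_pow, h1, QuotientGroup.mk_one]

end Quotients

/-- The situation of a relatively free group `H`, its extension `G` by an abelian kernel and
letters `x` for which Fox calculus determines the elements of `G`. -/
structure IsFoxSetting {X G H : Type*} [Group G] [Group H] (ν : G →* H) (x : X → G)
    (D : G → X →₀ MonoidAlgebra ℤ H) : Prop extends IsFoxDerivation ν x D where
  basis : IsRelBasis x
  basis' : IsRelBasis (ν ∘ x)
  eq_one_of_eq_zero : ∀ g, D g = 0 → g = 1
  exact : ∀ p, foxBoundary (ν ∘ x) p = 0 → ∃ ρ ∈ ν.ker, D ρ = p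
  exists_degree : ∀ f : X → ℤ, ∃ δ : H →* Multiplicative ℤ,
    ∀ i, δ ((ν ∘ x) i) = Multiplicative.ofAdd (f i)
  torsionFree : ∀ (h : H) (n : ℕ), n ≠ 0 → h ^ n = 1 → h = 1

namespace IsFoxSetting

section Substitution

variable {X G H : Type*} [Group G] [Group H] {ν : G →* H} {x : X → G}
  {D : G → X →₀ MonoidAlgebra ℤ H} (hS : IsFoxSetting ν x D)

/-- The endomorphism of `ℤ[H]` induced by a substitution in `H`. -/
noncomputable def subRing (t : X) (h : H) : MonoidAlgebra ℤ H →+* MonoidAlgebra ℤ H :=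
  mapDomainRingHom ℤ (hS.basis'.sub t h)

@[simp] lemma subRing_of (t : X) (h a : H) :
    hS.subRing t h (of ℤ H a) = of ℤ H (hS.basis'.sub t h a) := by
  simp [subRing, of]

lemma map_sub (t : X) (g y : G) : ν (hS.basis.sub t g y) = hS.basis'.sub t (ν g) (ν y) := by
  refine hS.basis.hom_congr (φ := ν.comp (hS.basis.sub t g))
    (ψ := (hS.basis'.sub t (ν g)).comp ν) (fun i => ?_) y
  by_cases hi : i = t
  · subst hi
    simp only [MonoidHom.comp_apply, IsRelBasis.sub_self]
    exact (hS.basis'.sub_self i (ν g)).symm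
  · simp only [MonoidHom.comp_apply, hS.basis.sub_of_ne hi]
    exact (hS.basis'.sub_of_ne hi (ν g)).symm

open Classical in
lemma D_sub (t : X) (g y : G) (u : X) : D (hS.basis.sub t g y) u =
    (if u = t then 0 else hS.subRing t (ν g) (D y u)) + hS.subRing t (ν g) (D y t) * D g u := by
  refine hS.basis.generators_induction (p := fun y => D (hS.basis.sub t g y) u =
    (if u = t then 0 else hS.subRing t (ν g) (D y u)) + hS.subRing t (ν g) (D y t) * D g u)
    (fun i => ?_) ?_ (fun a b ha hb => ?_) (fun a ha => ?_) y
  · by_cases hi : i = t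
    · subst hi
      rw [hS.basis.sub_self, hS.map_letter, Finsupp.single_eq_same, map_one, one_mul]
      split_ifs with h
      · rw [zero_add]
      · rw [Finsupp.single_eq_of_ne h, map_zero, zero_add]
    · rw [hS.basis.sub_of_ne hi, hS.map_letter, Finsupp.single_eq_of_ne (Ne.symm hi), map_zero,
        zero_mul, add_zero]
      split_ifs with h
      · subst h; rw [Finsupp.single_eq_of_ne (Ne.symm hi)]
      · by_cases hu : u = i
        · subst hu; simp
        · rw [Finsupp.single_eq_of_ne hu, map_zero]
  · simp [hS.toIsFoxDerivation.map_one]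
  · rw [_root_.map_mul, hS.map_mul, hS.map_mul, Finsupp.add_apply, Finsupp.smul_apply, ha, hb,
      hS.map_sub]
    simp only [Finsupp.add_apply, Finsupp.smul_apply, smul_eq_mul, map_add, _root_.map_mul,
      subRing_of]
    split_ifs <;> noncomm_ring
  · rw [_root_.map_inv, hS.toIsFoxDerivation.map_inv, hS.toIsFoxDerivation.map_inv,
      Finsupp.neg_apply, Finsupp.smul_apply, ha, ← _root_.map_inv, ← _root_.map_inv, hS.map_sub]
    simp only [Finsupp.neg_apply, Finsupp.smul_apply, smul_eq_mul, map_neg, _root_.map_mul,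
      subRing_of, _root_.map_inv]
    split_ifs <;> noncomm_ring

lemma D_eq_zero_of_fresh {t : X} {y : G} (hy : hS.basis.Fresh t y) : D y t = 0 := by
  rw [← show hS.basis.sub t 1 y = y from hy, hS.D_sub]
  simp [hS.toIsFoxDerivation.map_one]

lemma subRing_D_of_fresh {t : X} {y : G} (hy : hS.basis.Fresh t y) {u : X} (hu : u ≠ t) :
    hS.subRing t 1 (D y u) = D y u := by
  have h := hS.D_sub t 1 y u
  rw [show hS.basis.sub t 1 y = y from hy] at h
  simpa [hu, hS.toIsFoxDerivation.map_one] using h.symm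

lemma subRing_subRing_one (t : X) (h : H) (y : MonoidAlgebra ℤ H) :
    hS.subRing t h (hS.subRing t 1 y) = hS.subRing t 1 y := by
  have : ((hS.subRing t h).comp (hS.subRing t 1)).toAddMonoidHom =
      (hS.subRing t 1).toAddMonoidHom :=
    int_addHom_ext fun m => by
      change hS.subRing t h (hS.subRing t 1 (of ℤ H m)) = hS.subRing t 1 (of ℤ H m)
      rw [subRing_of, subRing_of, hS.basis'.sub_sub_one]
  exact DFunLike.congr_fun this y

include hS in
lemma D_injective : Function.Injective D := by
  intro g h hgh
  have hν : ν g = ν h := by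
    have h1 := hS.boundary hS.basis.closure_eq g
    rw [hgh, hS.boundary hS.basis.closure_eq h] at h1
    exact of_injective (sub_left_inj.1 h1.symm)
  refine mul_inv_eq_one.1 (hS.eq_one_of_eq_zero _ ?_)
  rw [hS.map_mul, hS.toIsFoxDerivation.map_inv, hgh, hν, smul_neg, smul_smul, ← _root_.map_mul,
    mul_inv_cancel, _root_.map_one, one_smul, add_neg_cancel]

include hS in
lemma eq_zero_of_smul_eq {k : H} (hk : k ≠ 1) {y : MonoidAlgebra ℤ H}
    (hy : of ℤ H k * y = y) : y = 0 := by
  by_contra hne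
  have hpow : ∀ n : ℕ, ∀ a, y.coeff (k ^ n * a) = y.coeff a := by
    intro n
    induction n with
    | zero => simp
    | succ n ih =>
      intro a
      rw [pow_succ', mul_assoc, ← ih a]
      conv_lhs => rw [← hy]
      simp [of]
  obtain ⟨a, ha⟩ : ∃ a, y.coeff a ≠ 0 := by
    by_contra! h
    exact hne (coeff_injective (Finsupp.ext h))
  have hinj : Function.Injective fun n : ℕ => k ^ n * a := by
    intro m n hmn
    have hmn' : k ^ m = k ^ n := mul_right_cancel hmn
    by_contra hne'
    rcases lt_or_gt_of_ne hne' with h | h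
    · refine hk (hS.torsionFree k (n - m) (by omega) ?_)
      rw [pow_sub _ h.le, hmn', mul_inv_cancel]
    · refine hk (hS.torsionFree k (m - n) (by omega) ?_)
      rw [pow_sub _ h.le, hmn', mul_inv_cancel]
  refine Set.infinite_range_of_injective hinj (y.coeff.support.finite_toSet.subset ?_)
  rintro _ ⟨n, rfl⟩
  simpa [hpow n a] using ha

include hS in
lemma letter_ne_one (t : X) : ν (x t) ≠ 1 := by
  obtain ⟨δ, hδ⟩ := hS.exists_degree fun _ => 1
  intro h
  have h1 := hδ t
  rw [Function.comp_apply, h, map_one] at h1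
  simpa using congrArg Multiplicative.toAdd h1

end Substitution

end IsFoxSetting

namespace IsRelBasis

variable {X Γ : Type*} [Group Γ] {x : X → Γ} (hx : IsRelBasis x)

/-- All values of the automorphism `π` arise from its value at almost any letter by
substitution. -/
def Uniform (π : MulAut Γ) : Prop :=
  ∀ᶠ t in Filter.cofinite, ∀ g, hx.sub t g (π (x t)) = π g

lemma sub_one_sub {t u : X} (h : u ≠ t) (a g : Γ) :
    hx.sub u 1 (hx.sub t a (hx.sub u 1 g)) = hx.sub t (hx.sub u 1 a) (hx.sub u 1 g) := by
  refine hx.hom_congr (φ := (hx.sub u 1).comp ((hx.sub t a).comp (hx.sub u 1)))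
    (ψ := (hx.sub t (hx.sub u 1 a)).comp (hx.sub u 1)) (fun i => ?_) g
  by_cases hi : i = u
  · subst hi; simp
  · by_cases hi' : i = t
    · subst hi'; simp [hx.sub_of_ne hi]
    · simp [hx.sub_of_ne hi, hx.sub_of_ne hi']

lemma sub_letter (t : X) (g : Γ) : hx.sub t (x t) g = g := by
  refine hx.hom_congr (φ := hx.sub t (x t)) (ψ := MonoidHom.id _) (fun i => ?_) g
  by_cases hi : i = t
  · subst hi; simp
  · simp [hx.sub_of_ne hi]

end IsRelBasis

namespace IsFoxSetting

section Coefficient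

variable {X G H : Type*} [Group G] [Group H] {ν : G →* H} {x : X → G}
  {D : G → X →₀ MonoidAlgebra ℤ H} (hS : IsFoxSetting ν x D)

lemma subRing_one_subRing {t u : X} (h : u ≠ t) (a : H) (y : MonoidAlgebra ℤ H) :
    hS.subRing u 1 (hS.subRing t a (hS.subRing u 1 y)) =
      hS.subRing t (hS.basis'.sub u 1 a) (hS.subRing u 1 y) := by
  have : (((hS.subRing u 1).comp (hS.subRing t a)).comp (hS.subRing u 1)).toAddMonoidHom =
      ((hS.subRing t (hS.basis'.sub u 1 a)).comp (hS.subRing u 1)).toAddMonoidHom :=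
    int_addHom_ext fun m => by
      change hS.subRing u 1 (hS.subRing t a (hS.subRing u 1 (of ℤ H m))) =
        hS.subRing t (hS.basis'.sub u 1 a) (hS.subRing u 1 (of ℤ H m))
      simp only [subRing_of, hS.basis'.sub_one_sub h]
  exact DFunLike.congr_fun this y

lemma subRing_letter (t : X) (y : MonoidAlgebra ℤ H) : hS.subRing t (ν (x t)) y = y := by
  have : (hS.subRing t (ν (x t))).toAddMonoidHom = AddMonoidHom.id _ :=
    int_addHom_ext fun m => by
      change hS.subRing t (ν (x t)) (of ℤ H m) = of ℤ H m
      rw [subRing_of]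
      exact congrArg _ (hS.basis'.sub_letter t m)
  exact DFunLike.congr_fun this y

variable {π : MulAut G}

lemma D_apply_of_sub {t : X} (ht : ∀ g, hS.basis.sub t g (π (x t)) = π g) {u : X}
    (hu : u = t ∨ D (π (x t)) u = 0) (g : G) :
    D (π g) u = hS.subRing t (ν g) (D (π (x t)) t) * D g u := by
  rw [← ht g, hS.D_sub]
  split_ifs with h
  · rw [zero_add]
  · rw [hu.resolve_left h, map_zero, zero_add]

variable [Infinite X]

lemma exists_coeff (hπ : hS.basis.Uniform π) :
    ∃ q, ∀ᶠ u in Filter.cofinite, ∀ g, D (π g) u = q * D g u := by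
  obtain ⟨t, ht⟩ := Filter.Eventually.exists hπ
  obtain ⟨u, hut, hu⟩ := hS.basis.exists_fresh {t} (Set.finite_singleton t) (π (x t))
  replace hut : u ≠ t := hut
  set p := D (π (x t)) t with hp
  have hpu : D (π (x t)) u = 0 := hS.D_eq_zero_of_fresh hu
  have hc := fun g => hS.D_apply_of_sub ht (Or.inr hpu) g
  have hfresh : hS.subRing u 1 p = p := hS.subRing_D_of_fresh hu (Ne.symm hut)
  have h1 : hS.subRing t (ν (x u * x t)) p = hS.subRing t (ν (x u)) p := by
    have h2 := hc (x u * x t)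
    rw [_root_.map_mul π, hS.map_mul, hS.map_mul, Finsupp.add_apply, Finsupp.add_apply,
      Finsupp.smul_apply, Finsupp.smul_apply, hc, hpu, hS.map_letter, hS.map_letter,
      Finsupp.single_eq_same, Finsupp.single_eq_of_ne hut] at h2
    simpa using h2.symm
  have key : hS.subRing t 1 p = p := by
    have h3 := congrArg (hS.subRing u 1) h1
    rw [← hfresh, hS.subRing_one_subRing hut, hS.subRing_one_subRing hut, hfresh] at h3
    have e1 : hS.basis'.sub u 1 (ν (x u)) = 1 := hS.basis'.sub_self u 1
    have e2 : hS.basis'.sub u 1 (ν (x t)) = ν (x t) := hS.basis'.sub_of_ne (Ne.symm hut) 1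
    rw [_root_.map_mul ν, _root_.map_mul, e1, e2, one_mul, subRing_letter] at h3
    exact h3.symm
  refine ⟨p, ?_⟩
  filter_upwards [(D (π (x t))).support.finite_toSet.compl_mem_cofinite] with v hv g
  rw [hS.D_apply_of_sub ht (Or.inr (by simpa using hv)), ← hp, ← key, subRing_subRing_one]

include hS in
lemma coeff_mul_of {q : MonoidAlgebra ℤ H}
    (hq : ∀ᶠ u in Filter.cofinite, ∀ g, D (π g) u = q * D g u) (g : G) :
    q * of ℤ H (ν g) = of ℤ H (ν (π g)) * q := by
  obtain ⟨u, h1, h2⟩ := (hq.and (hS.basis.eventually_fresh g)).exists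
  have h3 := h1 (g * x u)
  have h0 : D g u = 0 := hS.D_eq_zero_of_fresh h2
  rw [_root_.map_mul π, hS.map_mul, hS.map_mul, Finsupp.add_apply, Finsupp.add_apply,
    Finsupp.smul_apply, Finsupp.smul_apply, h1, h1, h0, hS.map_letter, Finsupp.single_eq_same]
    at h3
  simpa [-of_apply] using h3.symm

include hS in
lemma coeff_inv_mul {q q' : MonoidAlgebra ℤ H}
    (hq : ∀ᶠ u in Filter.cofinite, ∀ g, D (π g) u = q * D g u)
    (hq' : ∀ᶠ u in Filter.cofinite, ∀ g, D (π⁻¹ g) u = q' * D g u) : q' * q = 1 := by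
  obtain ⟨u, h1, h2⟩ := (hq.and hq').exists
  have h3 := h2 (π (x u))
  rw [MulAut.inv_apply_self, h1, hS.map_letter, Finsupp.single_eq_same, mul_one] at h3
  exact h3.symm

lemma mem_support_conj (hπ : hS.basis.Uniform π) {q : MonoidAlgebra ℤ H}
    (hq : ∀ g, q * of ℤ H (ν g) = of ℤ H (ν (π g)) * q) {a : H} (ha : q.coeff a ≠ 0) (g : G) :
    ν (π g) * a = a * ν g := by
  have hfr : ∀ᶠ t in Filter.cofinite, ∀ b ∈ q.coeff.support, hS.basis'.Fresh t b :=
    (Filter.eventually_all_finset _).2 fun b _ => hS.basis'.eventually_fresh b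
  obtain ⟨t, h1, h2⟩ := (Filter.Eventually.and hπ hfr).exists
  set b := ν (π (x t)) * a * (ν (x t))⁻¹ with hb
  have hbq : q.coeff b ≠ 0 := by
    have h3 := congrArg (fun y => y.coeff (ν (π (x t)) * a)) (hq (x t))
    simp [of] at h3
    rw [hb, h3]
    exact ha
  have hbe : ν (π (x t)) * a = b * ν (x t) := by rw [hb, inv_mul_cancel_right]
  have key : ∀ g, ν (π g) * a = b * ν g := by
    intro g
    have h4 := congrArg (hS.basis'.sub t (ν g)) hbe
    have e : hS.basis'.sub t (ν g) (ν (x t)) = ν g := hS.basis'.sub_self t (ν g)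
    rwa [_root_.map_mul, _root_.map_mul, ← hS.map_sub, h1, e,
      hS.basis'.sub_fresh (h2 a (by simpa using ha)),
      hS.basis'.sub_fresh (h2 b (by simpa using hbq))] at h4
  have h5 := key 1
  rw [_root_.map_one, _root_.map_one, one_mul, mul_one] at h5
  rw [h5]
  rw [h5] at key
  exact key g

end Coefficient

end IsFoxSetting

lemma twoUniqueProds_of_isMulTorsionFree (C : Type*) [CommGroup C] [IsMulTorsionFree C] :
    TwoUniqueProds C := by
  have : TwoUniqueSums (Additive C) :=
    TwoUniqueSums.of_injective_addHom
      (DivisibleHull.coeAddMonoidHom (M := Additive C)).toAddHom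
      DivisibleHull.coe_injective inferInstance
  exact Multiplicative.instTwoUniqueProdsOfTwoUniqueSums (M := Additive C)

namespace MonoidAlgebra

/-- A unit of the group ring supported in the centre of a torsion-free group is trivial. -/
lemma exists_single_of_mul_eq_one {H : Type*} [Group H]
    (hH : ∀ (h : H) (n : ℕ), n ≠ 0 → h ^ n = 1 → h = 1) {y z : MonoidAlgebra ℤ H}
    (hy : ∀ a, y.coeff a ≠ 0 → a ∈ Subgroup.center H)
    (hz : ∀ a, z.coeff a ≠ 0 → a ∈ Subgroup.center H) (hyz : y * z = 1) :
    ∃ a n, y = single a n := by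
  classical
  let _ : CommGroup (Subgroup.center H) :=
    { (inferInstance : Group (Subgroup.center H)) with
      mul_comm := fun a b => Subtype.ext (Subgroup.mem_center_iff.1 b.2 a) }
  have : IsMulTorsionFree (Subgroup.center H) := by
    refine ⟨fun n hn a b hab => ?_⟩
    have h1 : ((a * b⁻¹ : Subgroup.center H) : H) ^ n = 1 := by
      rw [← Subgroup.coe_pow, mul_pow, show a ^ n = b ^ n from hab, inv_pow, mul_inv_cancel,
        Subgroup.coe_one]
    exact mul_inv_eq_one.1 (Subtype.ext (hH _ n hn h1))
  have := twoUniqueProds_of_isMulTorsionFree (Subgroup.center H)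
  set A := y.coeff.support.subtype (· ∈ Subgroup.center H) with hA
  set B := z.coeff.support.subtype (· ∈ Subgroup.center H) with hB
  have hU : ∀ p ∈ A ×ˢ B, UniqueMul A B p.1 p.2 → (p.1 * p.2 : H) = 1 := by
    intro p hp h
    have h1 : UniqueMul y.coeff.support z.coeff.support (p.1 : H) p.2 := by
      intro a b ha hb hab
      have ha' := hy a (by simpa using ha)
      have hb' := hz b (by simpa using hb)
      have := h (a := ⟨a, ha'⟩) (b := ⟨b, hb'⟩) (by simpa [hA] using ha) (by simpa [hB] using hb)
        (Subtype.ext hab)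
      exact ⟨congrArg Subtype.val this.1, congrArg Subtype.val this.2⟩
    have h2 := coeff_mul_mul_of_uniqueMul h1
    rw [hyz] at h2
    by_contra hne
    rw [Finset.mem_product] at hp
    have h3 : y.coeff p.1 ≠ 0 := by simpa [hA] using hp.1
    have h4 : z.coeff p.2 ≠ 0 := by simpa [hB] using hp.2
    rw [one_def, coeff_single, Finsupp.single_eq_of_ne hne] at h2
    exact mul_ne_zero h3 h4 h2.symm
  have hcard : ¬ 1 < A.card * B.card := by
    intro hlt
    obtain ⟨p, hp, r, hr, hne, h1, h2⟩ := TwoUniqueProds.uniqueMul_of_one_lt_card hlt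
    have e : p.1 * p.2 = r.1 * r.2 :=
      Subtype.ext ((hU p hp h1).trans (hU r hr h2).symm)
    rw [Finset.mem_product] at hp hr
    obtain ⟨e1, e2⟩ := h2 hp.1 hp.2 e
    exact hne (Prod.ext e1 e2)
  have hA1 : A.card = y.coeff.support.card := by
    rw [hA, Finset.card_subtype, Finset.filter_true_of_mem fun a ha => hy a (by simpa using ha)]
  have hB1 : B.card = z.coeff.support.card := by
    rw [hB, Finset.card_subtype, Finset.filter_true_of_mem fun a ha => hz a (by simpa using ha)]
  have hy0 : y.coeff.support.card ≠ 0 := by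
    intro h
    have : y = 0 := coeff_injective (by simpa using h)
    simp [this] at hyz
  have hz0 : z.coeff.support.card ≠ 0 := by
    intro h
    have : z = 0 := coeff_injective (by simpa using h)
    simp [this] at hyz
  have hone : y.coeff.support.card = 1 := by
    rw [hA1, hB1] at hcard
    have := Nat.pos_of_ne_zero hz0
    have := Nat.pos_of_ne_zero hy0
    nlinarith
  obtain ⟨a, n, -, h⟩ := Finsupp.card_support_eq_one'.1 hone
  exact ⟨a, n, coeff_injective (by rw [h, coeff_single])⟩

end MonoidAlgebra

namespace IsFoxSetting

section Degree

variable {X G H : Type*} [Group G] [Group H] {ν : G →* H} {x : X → G}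
  {D : G → X →₀ MonoidAlgebra ℤ H} (hS : IsFoxSetting ν x D)
include hS

open Classical in
lemma augmentation_D (t : X) (δ : H →* Multiplicative ℤ)
    (hδ : ∀ i, δ (ν (x i)) = Multiplicative.ofAdd (if i = t then 1 else 0)) (g : G) :
    intLift (fun _ : H => (1 : ℤ)) (D g t) = (δ (ν g)).toAdd := by
  have hε : ∀ (a : H) (y : MonoidAlgebra ℤ H),
      intLift (fun _ : H => (1 : ℤ)) (of ℤ H a * y) = intLift (fun _ : H => (1 : ℤ)) y := by
    intro a y
    have : (intLift (fun _ : H => (1 : ℤ))).comp (AddMonoidHom.mulLeft (of ℤ H a)) =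
        intLift (fun _ : H => (1 : ℤ)) :=
      int_addHom_ext fun m => by
        rw [AddMonoidHom.comp_apply, AddMonoidHom.coe_mulLeft, ← _root_.map_mul, intLift_of,
          intLift_of]
    exact DFunLike.congr_fun this y
  refine hS.basis.generators_induction
    (p := fun g => intLift (fun _ : H => (1 : ℤ)) (D g t) = (δ (ν g)).toAdd)
    (fun i => ?_) ?_ (fun a b ha hb => ?_) (fun a ha => ?_) g
  · rw [hδ, hS.map_letter]
    by_cases hi : i = t
    · subst hi
      rw [Finsupp.single_eq_same, ← _root_.map_one (of ℤ H), intLift_of]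
      simp
    · rw [Finsupp.single_eq_of_ne (Ne.symm hi)]
      simp [hi]
  · simp [hS.toIsFoxDerivation.map_one]
  · rw [hS.map_mul, Finsupp.add_apply, Finsupp.smul_apply, smul_eq_mul, map_add, hε, ha, hb]
    simp
  · rw [hS.toIsFoxDerivation.map_inv, Finsupp.neg_apply, Finsupp.smul_apply, smul_eq_mul, map_neg,
      hε, ha]
    simp

variable [Infinite X]

lemma exists_conj (hν : Function.Surjective ν) {π : MulAut G} (hπ : hS.basis.Uniform π)
    (hπ' : hS.basis.Uniform π⁻¹) :
    ∃ a, (∀ g, ν (π g) * a = a * ν g) ∧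
      ∀ᶠ u in Filter.cofinite, ∀ g, D (π g) u = of ℤ H a * D g u := by
  obtain ⟨q, hq⟩ := hS.exists_coeff hπ
  obtain ⟨q', hq'⟩ := hS.exists_coeff hπ'
  have hqq : q' * q = 1 := hS.coeff_inv_mul hq hq'
  have hqq' : q * q' = 1 := hS.coeff_inv_mul (π := π⁻¹) hq' (by rwa [inv_inv])
  have hs := fun a ha g => hS.mem_support_conj hπ (a := a) (hS.coeff_mul_of hq) ha g
  have hs' := fun a ha g => hS.mem_support_conj hπ' (a := a) (hS.coeff_mul_of hq') ha g
  obtain ⟨a₀, ha₀⟩ : ∃ a, q.coeff a ≠ 0 := by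
    by_contra! h
    have : q = 0 := coeff_injective (Finsupp.ext h)
    simp [this] at hqq
  obtain ⟨b, n, hbn⟩ := exists_single_of_mul_eq_one (y := of ℤ H a₀⁻¹ * q) (z := q' * of ℤ H a₀)
    hS.torsionFree
    (fun b hb => by
      have hb' : q.coeff (a₀ * b) ≠ 0 := by simpa [of] using hb
      rw [Subgroup.mem_center_iff]
      intro h
      obtain ⟨g, rfl⟩ := hν h
      have h1 := hs _ hb' g
      rw [← mul_assoc, hs _ ha₀, mul_assoc, mul_assoc] at h1
      exact mul_left_cancel h1)
    (fun b hb => by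
      have hb' : q'.coeff (b * a₀⁻¹) ≠ 0 := by simpa [of] using hb
      rw [Subgroup.mem_center_iff]
      intro h
      obtain ⟨g, rfl⟩ := hν h
      have h1 := hs' _ hb' (π g)
      rw [MulAut.inv_apply_self] at h1
      have h2 : a₀⁻¹ * ν (π g) = ν g * a₀⁻¹ := by
        rw [inv_mul_eq_iff_eq_mul, ← mul_assoc, ← hs _ ha₀, mul_inv_cancel_right]
      rw [mul_assoc b, h2, ← mul_assoc, ← mul_assoc] at h1
      exact mul_right_cancel h1)
    (by
      rw [mul_assoc, ← mul_assoc q, hqq', one_mul, ← _root_.map_mul, inv_mul_cancel,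
        _root_.map_one])
  have hqa : q = single (a₀ * b) n := by
    have h1 := congrArg (of ℤ H a₀ * ·) hbn
    simp only [← mul_assoc, ← _root_.map_mul, mul_inv_cancel, _root_.map_one, one_mul] at h1
    rw [h1, of_apply, single_mul_single, one_mul]
  have hn : n ≠ 0 := by
    rintro rfl
    rw [hqa] at ha₀
    simp at ha₀
  have hab := hs (a₀ * b) (by rw [hqa]; simpa using hn)
  obtain ⟨t, ht⟩ := hq.exists
  classical
  obtain ⟨δ, hδ⟩ := hS.exists_degree fun i => if i = t then 1 else 0
  have h1 := hS.augmentation_D t δ hδ (π (x t))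
  have h2 : δ (ν (π (x t))) = δ (ν (x t)) := by
    have := congrArg δ (hab (x t))
    rw [_root_.map_mul δ (ν (π (x t))), _root_.map_mul δ (a₀ * b), mul_comm] at this
    exact mul_left_cancel this
  have hof : q = n • of ℤ H (a₀ * b) := by rw [hqa]; simp [of]
  have h3 : δ (ν (x t)) = Multiplicative.ofAdd 1 := by simpa using hδ t
  rw [ht, hS.map_letter, Finsupp.single_eq_same, mul_one, hof, map_zsmul, intLift_of, h2,
    h3, smul_eq_mul, mul_one, toAdd_ofAdd] at h1
  refine ⟨a₀ * b, hab, ?_⟩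
  filter_upwards [hq] with u hu g
  rw [hu, hof, h1, one_smul]

end Degree

end IsFoxSetting

namespace IsRelBasis

variable {X Γ : Type*} [Group Γ] {x : X → Γ} (hx : IsRelBasis x)

lemma fresh_of_fresh_sub_letter {t u : X} (hut : u ≠ t) {h : Γ} (hu : hx.Fresh u h)
    (hs : hx.Fresh u (hx.sub t (x u) h)) : hx.Fresh t h := by
  have h1 : hx.sub t (x u) h = hx.sub t 1 h := by
    have h2 := hx.sub_one_sub hut (x u) h
    rwa [show hx.sub u 1 h = h from hu, sub_self, show hx.sub u 1 (hx.sub t (x u) h) = _ from hs]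
      at h2
  have h3 : hx.sub u (x t) (hx.sub t (x u) h) = h := by
    conv_rhs => rw [← show hx.sub u 1 h = h from hu]
    conv_lhs => rw [← show hx.sub u 1 h = h from hu]
    refine hx.hom_congr (φ := (hx.sub u (x t)).comp ((hx.sub t (x u)).comp (hx.sub u 1)))
      (ψ := hx.sub u 1) (fun i => ?_) h
    by_cases hi : i = u
    · subst hi; simp
    · by_cases hi' : i = t
      · subst hi'; simp [hx.sub_of_ne hi]
      · simp [hx.sub_of_ne hi, hx.sub_of_ne hi']
  have h4 : hx.Fresh u (hx.sub t 1 h) := h1 ▸ hs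
  rw [h1, hx.sub_fresh h4] at h3
  exact h3

lemma fresh_of_fresh_sub_mul {t u : X} (hut : u ≠ t) {h : Γ} (hu : hx.Fresh u h)
    (hs : hx.Fresh u (hx.sub t (x t * x u) h)) : hx.Fresh t h := by
  have h1 : hx.sub t (x t * x u) h = h := by
    have h2 := hx.sub_one_sub hut (x t * x u) h
    rwa [show hx.sub u 1 h = h from hu, map_mul, sub_self, hx.sub_of_ne hut.symm, mul_one,
      sub_letter, show hx.sub u 1 (hx.sub t (x t * x u) h) = _ from hs] at h2
  have h3 : hx.sub t (x u) h = hx.sub t 1 h := by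
    conv_rhs => rw [← h1]
    refine hx.hom_congr (φ := hx.sub t (x u)) (ψ := (hx.sub t 1).comp (hx.sub t (x t * x u)))
      (fun i => ?_) h
    by_cases hi : i = t
    · subst hi; simp [hx.sub_of_ne hut]
    · simp [hx.sub_of_ne hi]
  refine hx.fresh_of_fresh_sub_letter hut hu ?_
  have h4 := hx.sub_one_sub hut 1 h
  rw [show hx.sub u 1 h = h from hu, map_one] at h4
  rw [h3]
  exact h4

end IsRelBasis

namespace IsFoxSetting

section FreshPart

variable {X G H : Type*} [Group G] [Group H] {ν : G →* H} {x : X → G}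
  {D : G → X →₀ MonoidAlgebra ℤ H} (hS : IsFoxSetting ν x D)

open Classical in
/-- The part of a group ring element supported on the elements free of the letter `u`. -/
noncomputable def freshPart (u : X) : MonoidAlgebra ℤ H →+ MonoidAlgebra ℤ H :=
  intLift fun h => if hS.basis'.Fresh u h then of ℤ H h else 0

lemma freshPart_of {u : X} {h : H} (hu : hS.basis'.Fresh u h) :
    hS.freshPart u (of ℤ H h) = of ℤ H h := by
  rw [freshPart, intLift_of, if_pos hu]

lemma freshPart_of_not {u : X} {h : H} (hu : ¬ hS.basis'.Fresh u h) :
    hS.freshPart u (of ℤ H h) = 0 := by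
  rw [freshPart, intLift_of, if_neg hu]

lemma freshPart_of_mul {u : X} {a : H} (ha : hS.basis'.Fresh u a) (y : MonoidAlgebra ℤ H) :
    hS.freshPart u (of ℤ H a * y) = of ℤ H a * hS.freshPart u y := by
  have : (hS.freshPart u).comp (AddMonoidHom.mulLeft (of ℤ H a)) =
      (AddMonoidHom.mulLeft (of ℤ H a)).comp (hS.freshPart u) :=
    int_addHom_ext fun m => by
      simp only [AddMonoidHom.comp_apply, AddMonoidHom.coe_mulLeft, ← _root_.map_mul]
      by_cases hm : hS.basis'.Fresh u m
      · rw [hS.freshPart_of hm, hS.freshPart_of (ha.mul hm), _root_.map_mul]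
      · rw [hS.freshPart_of_not hm, hS.freshPart_of_not, mul_zero]
        intro h
        exact hm (by simpa using ha.inv.mul h)
  exact DFunLike.congr_fun this y

lemma subRing_freshPart (t : X) (h : H) (y : MonoidAlgebra ℤ H) :
    hS.subRing t h (hS.freshPart t y) = hS.freshPart t y := by
  have : (hS.subRing t h).toAddMonoidHom.comp (hS.freshPart t) = hS.freshPart t :=
    int_addHom_ext fun m => by
      change hS.subRing t h (hS.freshPart t (of ℤ H m)) = _
      by_cases hm : hS.basis'.Fresh t m
      · rw [hS.freshPart_of hm, subRing_of, hS.basis'.sub_fresh hm]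
      · rw [hS.freshPart_of_not hm, map_zero]
  exact DFunLike.congr_fun this y

lemma freshPart_subRing {t u : X} {a : H}
    (h : ∀ m, hS.basis'.Fresh u m → hS.basis'.Fresh u (hS.basis'.sub t a m) →
      hS.basis'.Fresh t m) (y : MonoidAlgebra ℤ H) :
    hS.freshPart u (hS.subRing t a (hS.freshPart u y)) = hS.freshPart t (hS.freshPart u y) := by
  have : ((hS.freshPart u).comp (hS.subRing t a).toAddMonoidHom).comp (hS.freshPart u) =
      (hS.freshPart t).comp (hS.freshPart u) :=
    int_addHom_ext fun m => by
      change hS.freshPart u (hS.subRing t a (hS.freshPart u (of ℤ H m))) =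
        hS.freshPart t (hS.freshPart u (of ℤ H m))
      by_cases hm : hS.basis'.Fresh u m
      · rw [hS.freshPart_of hm, subRing_of]
        by_cases hm' : hS.basis'.Fresh t m
        · rw [hS.basis'.sub_fresh hm', hS.freshPart_of hm, hS.freshPart_of hm']
        · rw [hS.freshPart_of_not hm', hS.freshPart_of_not fun h' => hm' (h m hm h')]
      · simp only [hS.freshPart_of_not hm, map_zero]
  exact DFunLike.congr_fun this y

lemma eventually_freshPart (y : MonoidAlgebra ℤ H) :
    ∀ᶠ u in Filter.cofinite, hS.freshPart u y = y := by
  have hfr : ∀ᶠ t in Filter.cofinite, ∀ b ∈ y.coeff.support, hS.basis'.Fresh t b :=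
    (Filter.eventually_all_finset _).2 fun b _ => hS.basis'.eventually_fresh b
  filter_upwards [hfr] with u hu
  have hy : y = y.coeff.sum fun a n => n • of ℤ H a := by
    conv_lhs => rw [← sum_coeff_single y]
    simp [of]
  conv_rhs => rw [hy]
  conv_lhs => rw [hy]
  rw [Finsupp.sum, map_sum]
  refine Finset.sum_congr rfl fun a ha => ?_
  rw [map_zsmul, hS.freshPart_of (hu a ha)]

variable [Infinite X]

include hS in
lemma exists_conj_of_D_eq {π : MulAut G} (hπ : hS.basis.Uniform π) (hν : ∀ g, ν (π g) = ν g)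
    (hD : ∀ᶠ u in Filter.cofinite, ∀ g, D (π g) u = D g u) : ∃ ρ, π = MulAut.conj ρ := by
  obtain ⟨t, ht, htD⟩ := (Filter.Eventually.and hπ hD).exists
  set e := D (π (x t)) - D (x t) with he
  have het : e t = 0 := by rw [he, Finsupp.sub_apply, htD, sub_self]
  have hE : ∀ g u, D (π g) u = hS.subRing t (ν g) (e u) + D g u := by
    intro g u
    by_cases hu : u = t
    · subst hu
      rw [het, map_zero, zero_add, htD]
    · rw [← ht g, hS.D_sub, if_neg hu, htD, hS.map_letter, Finsupp.single_eq_same, map_one,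
        one_mul, he, Finsupp.sub_apply, hS.map_letter, Finsupp.single_eq_of_ne hu, sub_zero]
  obtain ⟨u, hut, hue⟩ : ∃ u, u ≠ t ∧ ∀ j, hS.freshPart u (e j) = e j := by
    have h1 : ∀ᶠ u in Filter.cofinite, ∀ j ∈ e.support, hS.freshPart u (e j) = e j :=
      (Filter.eventually_all_finset _).2 fun j _ => hS.eventually_freshPart (e j)
    have h2 : ∀ᶠ u in Filter.cofinite, u ∉ ({t} : Set X) :=
      (Set.finite_singleton t).compl_mem_cofinite
    obtain ⟨u, h3, h4⟩ := (h1.and h2).exists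
    refine ⟨u, h4, fun j => ?_⟩
    by_cases hj : j ∈ e.support
    · exact h3 j hj
    · rw [Finsupp.notMem_support_iff.1 hj, map_zero]
  set r := e.mapRange (hS.freshPart t) (map_zero _) with hr
  have her : ∀ j, r j = e j + of ℤ H (ν (x t)) * r j := by
    intro j
    have h1 := hE (x t * x u) j
    rw [_root_.map_mul π, hS.map_mul, hS.map_mul, Finsupp.add_apply, Finsupp.add_apply,
      Finsupp.smul_apply, Finsupp.smul_apply, hν, hE, hE, subRing_letter, smul_eq_mul, smul_eq_mul]
      at h1
    have h2 : hS.subRing t (ν (x t * x u)) (e j) =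
        e j + of ℤ H (ν (x t)) * hS.subRing t (ν (x u)) (e j) := by
      rw [mul_add, add_add_add_comm] at h1
      exact (add_right_cancel h1).symm
    have h3 := congrArg (hS.freshPart u) h2
    have hm : ∀ m, hS.basis'.Fresh u m → hS.basis'.Fresh u (hS.basis'.sub t (ν (x t * x u)) m) →
        hS.basis'.Fresh t m := fun m h h' => hS.basis'.fresh_of_fresh_sub_mul hut h
          (by rwa [_root_.map_mul] at h')
    have hm' : ∀ m, hS.basis'.Fresh u m → hS.basis'.Fresh u (hS.basis'.sub t (ν (x u)) m) →
        hS.basis'.Fresh t m := fun m h h' => hS.basis'.fresh_of_fresh_sub_letter hut h h'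
    have hr₁ : hS.freshPart u (hS.subRing t (ν (x t * x u)) (e j)) = r j := by
      conv_lhs => rw [← hue j]
      rw [hS.freshPart_subRing hm, hue]
      rfl
    have hr₂ : hS.freshPart u (hS.subRing t (ν (x u)) (e j)) = r j := by
      conv_lhs => rw [← hue j]
      rw [hS.freshPart_subRing hm', hue]
      rfl
    have hfl : hS.basis'.Fresh u (ν (x t)) := hS.basis'.fresh_letter (Ne.symm hut)
    rw [map_add, hS.freshPart_of_mul hfl, hue, hr₁, hr₂] at h3
    exact h3
  have her' : r = e + of ℤ H (ν (x t)) • r := Finsupp.ext her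
  have hbe : foxBoundary (ν ∘ x) e = 0 := by
    rw [he, _root_.map_sub, hS.boundary hS.basis.closure_eq, hS.boundary hS.basis.closure_eq, hν,
      sub_self]
  have hbr : foxBoundary (ν ∘ x) r = 0 := by
    refine hS.eq_zero_of_smul_eq (hS.letter_ne_one t) ?_
    conv_rhs => rw [her', map_add, hbe, zero_add, map_smul, smul_eq_mul]
  obtain ⟨ρ, hρ, hDρ⟩ := hS.exact r hbr
  rw [MonoidHom.mem_ker] at hρ
  have hconj : π (x t) = ρ * x t * ρ⁻¹ := by
    refine hS.D_injective ?_
    rw [hS.map_mul, hS.map_mul, hS.toIsFoxDerivation.map_inv, hDρ, _root_.map_mul, hρ, inv_one,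
      _root_.map_one, one_mul, one_smul, one_smul, smul_neg, eq_add_neg_iff_add_eq]
    conv_rhs => rw [her', he]
    abel
  have hfresh : hS.basis.Fresh t ρ := by
    refine hS.D_injective (Finsupp.ext fun v => ?_)
    rw [hS.D_sub, hDρ, hr]
    simp only [Finsupp.mapRange_apply, het, map_zero, zero_mul, add_zero, subRing_freshPart]
    split_ifs with hv
    · rw [hv, het, map_zero]
    · rfl
  refine ⟨ρ, MulEquiv.ext fun g => ?_⟩
  rw [← ht g, hconj, _root_.map_mul, _root_.map_mul, hS.basis.sub_self,
    hS.basis.sub_fresh hfresh, hS.basis.sub_fresh hfresh.inv, MulAut.conj_apply]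

end FreshPart

end IsFoxSetting

/-- Inversion preserves the size of conjugacy classes. -/
lemma mk_isConj_inv_le {A : Type*} [Group A] (a : A) :
    #{b : A | IsConj a⁻¹ b} ≤ #{b : A | IsConj a b} := by
  refine mk_le_of_injective (f := fun b => ⟨b.1⁻¹, ?_⟩) fun b c h => ?_
  · obtain ⟨c, hc⟩ := isConj_iff.1 b.2
    exact isConj_iff.2 ⟨c, by rw [← hc]; group⟩
  · exact Subtype.ext (inv_injective (congrArg Subtype.val h))

/-- Automorphisms preserve the size of conjugacy classes. -/
lemma mk_isConj_map_le {A : Type*} [Group A] (Φ : MulAut A) (a : A) :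
    #{b : A | IsConj (Φ a) b} ≤ #{b : A | IsConj a b} := by
  refine mk_le_of_injective (f := fun b => ⟨Φ.symm b.1, ?_⟩) fun b c h => ?_
  · have h := (MonoidHom.map_isConj Φ.symm.toMonoidHom b.2 :)
    simpa using h
  · exact Subtype.ext (Φ.symm.injective (congrArg Subtype.val h))

/-- The conjugacy class of an inner automorphism consists of inner automorphisms. -/
lemma mk_isConj_conj_le {Γ : Type*} [Group Γ] (g : Γ) :
    #{τ : MulAut Γ | IsConj (MulAut.conj g) τ} ≤ #Γ := by
  refine (mk_le_mk_of_subset (t := Set.range (MulAut.conj : Γ →* MulAut Γ)) ?_).trans mk_range_le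
  intro τ hτ
  obtain ⟨c, hc⟩ := isConj_iff.1 hτ
  exact ⟨c g, by rw [← hc]; ext y; simp⟩

namespace IsFoxSetting

section Inner

universe v w

variable {X G : Type v} {H : Type w} [Group G] [Group H] {ν : G →* H} {x : X → G}
  {D : G → X →₀ MonoidAlgebra ℤ H} (hS : IsFoxSetting ν x D) [Infinite X]
include hS

/-- Automorphisms with small conjugacy class are inner. -/
theorem exists_conj_of_small (hν : Function.Surjective ν) {π : MulAut G}
    (hπ : #{τ : MulAut G | IsConj π τ} ≤ #X) : ∃ g, π = MulAut.conj g := by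
  have h1 : hS.basis.Uniform π := hS.basis.eventually_sub_apply_of_small hπ
  have h2 : hS.basis.Uniform π⁻¹ :=
    hS.basis.eventually_sub_apply_of_small ((mk_isConj_inv_le π).trans hπ)
  obtain ⟨a, ha, haD⟩ := hS.exists_conj hν h1 h2
  obtain ⟨g₀, rfl⟩ := hν a
  have happ : ∀ g, ((MulAut.conj g₀)⁻¹ * π) g = g₀⁻¹ * π g * g₀ := fun g => by simp
  have hfr := hS.basis.eventually_fresh g₀
  obtain ⟨ρ, hρ⟩ := hS.exists_conj_of_D_eq (π := (MulAut.conj g₀)⁻¹ * π)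
    (by
      filter_upwards [hfr, h1] with t ht h g
      rw [happ, happ, map_mul, map_mul, hS.basis.sub_fresh ht, hS.basis.sub_fresh ht.inv, h])
    (fun g => by rw [happ, map_mul, map_mul, mul_assoc, ha, map_inv, inv_mul_cancel_left])
    (by
      filter_upwards [hfr, haD] with t ht h g
      rw [happ, mul_assoc, hS.map_mul, hS.map_mul, Finsupp.add_apply, Finsupp.smul_apply,
        Finsupp.add_apply, Finsupp.smul_apply, hS.D_eq_zero_of_fresh ht,
        hS.D_eq_zero_of_fresh ht.inv, smul_zero, add_zero, zero_add, h, smul_eq_mul, ← mul_assoc,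
        ← map_mul, map_inv, inv_mul_cancel, _root_.map_one, one_mul])
  exact ⟨g₀ * ρ, by rw [_root_.map_mul, ← hρ, mul_inv_cancel_left]⟩

end Inner

section Structure

variable {X G H : Type*} [Group G] [Group H] {ν : G →* H} {x : X → G}
  {D : G → X →₀ MonoidAlgebra ℤ H} (hS : IsFoxSetting ν x D)
include hS

lemma mem_ker_of_commute {k r : G} (hr : r ∈ ν.ker) (hr1 : r ≠ 1) (h : k * r * k⁻¹ = r) :
    k ∈ ν.ker := by
  rw [MonoidHom.mem_ker] at hr ⊢
  by_contra hk
  refine hr1 (hS.eq_one_of_eq_zero r (Finsupp.ext fun u => hS.eq_zero_of_smul_eq hk ?_))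
  have h1 := congrArg (fun y => D y u) (mul_inv_eq_iff_eq_mul.1 h)
  simp only [hS.map_mul, hr, _root_.map_one, one_smul, Finsupp.add_apply, Finsupp.smul_apply,
    smul_eq_mul] at h1
  rw [add_comm] at h1
  exact add_right_cancel h1

lemma not_commute_letter {i j : X} (hij : i ≠ j) : x i * x j ≠ x j * x i := by
  intro h
  have h1 := congrArg (fun y => D y i) h
  simp only [hS.map_mul, hS.map_letter, Finsupp.add_apply, Finsupp.smul_apply,
    Finsupp.single_eq_same, Finsupp.single_eq_of_ne hij, smul_eq_mul, mul_one, mul_zero,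
    add_zero, zero_add] at h1
  exact hS.letter_ne_one j (of_injective (h1.symm.trans (_root_.map_one _).symm))

variable [Infinite X]

lemma eq_one_of_conj_eq_one {c : G} (hc : ∀ g, c * g = g * c) : c = 1 := by
  obtain ⟨t, ht⟩ := (hS.basis.eventually_fresh c).exists
  have h1 : ∀ u, D c u + of ℤ H (ν c) * D (x t) u = D (x t) u + of ℤ H (ν (x t)) * D c u := by
    intro u
    have h := congrArg (fun y => D y u) (hc (x t))
    simpa only [hS.map_mul, Finsupp.add_apply, Finsupp.smul_apply, smul_eq_mul] using h
  have hνc : of ℤ H (ν c) = 1 := by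
    have h := h1 t
    rwa [hS.D_eq_zero_of_fresh ht, hS.map_letter, Finsupp.single_eq_same, mul_one, mul_zero,
      zero_add, add_zero] at h
  refine hS.eq_one_of_eq_zero c (Finsupp.ext fun u => ?_)
  refine hS.eq_zero_of_smul_eq (hS.letter_ne_one t) ?_
  have h := h1 u
  rw [hνc, one_mul, add_comm] at h
  exact (add_left_cancel h).symm

open scoped commutatorElement in
lemma ker_ne_bot (h : ∀ c ∈ commutator G, (∀ r ∈ ν.ker, MulAut.conj c r = r) →
    ∃ r ∈ ν.ker, MulAut.conj c = MulAut.conj r) : ν.ker ≠ ⊥ := by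
  intro hbot
  obtain ⟨i, j, hij⟩ := exists_pair_ne X
  obtain ⟨r, hr, hcr⟩ := h ⁅x i, x j⁆
    (Subgroup.commutator_mem_commutator (Subgroup.mem_top _) (Subgroup.mem_top _))
    (fun r hr => by
      rw [hbot, Subgroup.mem_bot] at hr
      rw [hr, _root_.map_one])
  rw [hbot, Subgroup.mem_bot] at hr
  rw [hr, _root_.map_one] at hcr
  have h1 := hS.eq_one_of_conj_eq_one (c := ⁅x i, x j⁆) fun g => by
    have := DFunLike.congr_fun hcr g
    rw [MulAut.conj_apply, MulAut.one_apply] at this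
    exact mul_inv_eq_iff_eq_mul.1 this
  exact hS.not_commute_letter hij (commutatorElement_eq_one_iff_mul_comm.1 h1)

/-- A subgroup containing the commutator subgroup, invariant under automorphisms and containing an
element with primitive image is everything. -/
lemma eq_top_of_primitive {M : Subgroup G} (hM : commutator G ≤ M)
    (hinv : ∀ (θ : MulAut G), ∀ m ∈ M, θ m ∈ M) {y : G} (hy : y ∈ M)
    (hprim : IsPrimitiveElement (ν y)) : M = ⊤ := by
  obtain ⟨B, hB, hyB⟩ := hprim
  obtain ⟨k, hk⟩ := (hS.basis.eventually_fresh y).exists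
  obtain ⟨φ, hφ, -⟩ := hB fun _ => ν (x k)
  obtain ⟨δ, hδ⟩ := hS.exists_degree fun _ => 1
  let ψ : G →* Multiplicative ℤ := ((δ.comp φ).comp ν).comp (hS.basis.sub k 1)
  have hψy : ψ y = Multiplicative.ofAdd 1 := by
    change δ (φ (ν (hS.basis.sub k 1 y))) = _
    rw [show hS.basis.sub k 1 y = y from hk, hφ ⟨_, hyB⟩]
    exact hδ k
  have hψk : ψ (x k) = 1 := by
    change δ (φ (ν (hS.basis.sub k 1 (x k)))) = _
    rw [hS.basis.sub_self, _root_.map_one, _root_.map_one, _root_.map_one]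
  have hu : x k ^ (ψ (x k)).toAdd = 1 := by
    rw [hψk, toAdd_one, zpow_zero]
  let U := hS.basis.lmulAut (fun i => x k ^ (ψ (x i)).toAdd)
    (fun i => by
      rw [map_zpow, hS.basis.lmul_apply, hu, one_mul])
    (fun i => by
      rw [map_zpow, hS.basis.lmul_apply, Pi.inv_apply, hu, inv_one, one_mul])
  have hU : Abelianization.of (U y) = Abelianization.of (x k * y) := by
    have h := hS.basis.hom_congr (φ := Abelianization.of.comp U.toMonoidHom)
      (ψ := (zpowersHom _ (Abelianization.of (x k))).comp ψ * Abelianization.of) (fun i => by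
        change Abelianization.of (U (x i)) =
          Abelianization.of (x k) ^ (ψ (x i)).toAdd * Abelianization.of (x i)
        rw [hS.basis.lmulAut_apply, _root_.map_mul, map_zpow]) y
    change Abelianization.of (U y) =
      Abelianization.of (x k) ^ (ψ y).toAdd * Abelianization.of y at h
    rw [h, hψy, toAdd_ofAdd, zpow_one, _root_.map_mul]
  have hkM : x k ∈ M := by
    have h1 : U y / (x k * y) ∈ M := hM (by
      rw [← Abelianization.ker_of, MonoidHom.mem_ker, _root_.map_div, hU, div_self'])
    have h2 := M.mul_mem (M.inv_mem h1) (hinv U y hy)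
    rw [inv_div, div_mul_cancel] at h2
    exact (M.mul_mem_cancel_right hy).1 h2
  rw [eq_top_iff, ← hS.basis.closure_eq, Subgroup.closure_le]
  rintro _ ⟨j, rfl⟩
  by_cases hj : j = k
  · rw [hj]; exact hkM
  · have h := hinv (hS.basis.transv k j hj) _ hkM
    rw [hS.basis.transv_self] at h
    exact (M.mul_mem_cancel_right hkM).1 h

end Structure

end IsFoxSetting

lemma exists_isFoxSetting {X : Type*} (R : Subgroup (FreeGroup X)) [R.Normal]
    (hR : ∀ f : FreeGroup X →* FreeGroup X, R.map f ≤ R) (hRF' : R ≤ commutator (FreeGroup X))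
    (hRTFN : ResiduallyTorsionFreeNilpotent (FreeGroup X ⧸ R)) :
    ∃ D, IsFoxSetting (natHom R) (letter R) D := by
  obtain ⟨D, hD⟩ := exists_isFoxDerivation R
  obtain ⟨h1, h2⟩ := hD.ker_exact (isRelBasis_letter hR).closure_eq (natHom_surjective R)
    (ker_natHom_comm R)
  exact ⟨D, { hD with
    basis := isRelBasis_letter hR
    basis' := isRelBasis_natHom_letter hR
    eq_one_of_eq_zero := h1
    exact := h2
    exists_degree := exists_degree hRF'
    torsionFree := fun _ _ hn h => hRTFN.eq_one_of_pow_eq_one hn h }⟩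

/-- Let `F = FreeGroup X` with `X` infinite, `R ≤ F'` fully invariant with `F/R`
residually torsion-free nilpotent, `G = F/R'`.  Suppose `σ ∈ Aut G` has small
conjugacy class, `σ = τ_x ∘ γ` with `γ` small-class fixing `R̂` pointwise and the
image of `x` in `F/R` primitive, and the subgroup `L(σ)` generated by the normal
closure of `σ` and `I_{G'}` contains no small-class automorphism fixing `R̂` pointwise
other than those of the form `τ_r`, `r ∈ R̂`.  Then `σ` is inner, `L(σ) = Inn G`, and
`Inn G` is characteristic in `Aut G`. -/
theorem primitive_lifting
    {X : Type*} [Infinite X] (R : Subgroup (FreeGroup X)) [R.Normal]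
    (hR : ∀ f : FreeGroup X →* FreeGroup X, R.map f ≤ R)
    (hRF' : R ≤ commutator (FreeGroup X))
    (hRTFN : ResiduallyTorsionFreeNilpotent (FreeGroup X ⧸ R))
    (σ : MulAut (FreeGroup X ⧸ ⁅R, R⁆))
    (ha : Cardinal.mk {τ : MulAut (FreeGroup X ⧸ ⁅R, R⁆) | IsConj σ τ} ≤ Cardinal.mk X)
    (hb : ∃ (x : FreeGroup X ⧸ ⁅R, R⁆) (γ : MulAut (FreeGroup X ⧸ ⁅R, R⁆)),
      σ = MulAut.conj x * γ ∧
      Cardinal.mk {τ : MulAut (FreeGroup X ⧸ ⁅R, R⁆) | IsConj γ τ} ≤ Cardinal.mk X ∧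
      (∀ r ∈ R.map (QuotientGroup.mk' ⁅R, R⁆), γ r = r) ∧
      IsPrimitiveElement (natHom R x))
    (hc : ∀ π ∈ Subgroup.normalClosure ({σ} : Set (MulAut (FreeGroup X ⧸ ⁅R, R⁆))) ⊔
        (commutator (FreeGroup X ⧸ ⁅R, R⁆)).map
          (MulAut.conj : (FreeGroup X ⧸ ⁅R, R⁆) →* MulAut (FreeGroup X ⧸ ⁅R, R⁆)),
      Cardinal.mk {τ : MulAut (FreeGroup X ⧸ ⁅R, R⁆) | IsConj π τ} ≤ Cardinal.mk X →
      (∀ r ∈ R.map (QuotientGroup.mk' ⁅R, R⁆), π r = r) →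
      ∃ r ∈ R.map (QuotientGroup.mk' ⁅R, R⁆), π = MulAut.conj r) :
    (∃ g : FreeGroup X ⧸ ⁅R, R⁆, σ = MulAut.conj g) ∧
    (Subgroup.normalClosure ({σ} : Set (MulAut (FreeGroup X ⧸ ⁅R, R⁆))) ⊔
        (commutator (FreeGroup X ⧸ ⁅R, R⁆)).map
          (MulAut.conj : (FreeGroup X ⧸ ⁅R, R⁆) →* MulAut (FreeGroup X ⧸ ⁅R, R⁆))
      = (MulAut.conj : (FreeGroup X ⧸ ⁅R, R⁆) →* MulAut (FreeGroup X ⧸ ⁅R, R⁆)).range) ∧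
    (∀ Φ : MulAut (MulAut (FreeGroup X ⧸ ⁅R, R⁆)),
      ((MulAut.conj : (FreeGroup X ⧸ ⁅R, R⁆) →* MulAut (FreeGroup X ⧸ ⁅R, R⁆)).range).map
          Φ.toMonoidHom
        = (MulAut.conj : (FreeGroup X ⧸ ⁅R, R⁆) →* MulAut (FreeGroup X ⧸ ⁅R, R⁆)).range) := by
  obtain ⟨D, hS⟩ := exists_isFoxSetting R hR hRF' hRTFN
  have hν := natHom_surjective R
  rw [← ker_natHom] at hb hc
  have hsmall : ∀ π : MulAut (FreeGroup X ⧸ ⁅R, R⁆),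
      #{τ : MulAut (FreeGroup X ⧸ ⁅R, R⁆) | IsConj π τ} ≤ #X ↔ π ∈ MulAut.conj.range := by
    refine fun π => ⟨fun h => ?_, ?_⟩
    · obtain ⟨g, rfl⟩ := hS.exists_conj_of_small hν h
      exact ⟨g, rfl⟩
    · rintro ⟨g, rfl⟩
      refine (mk_isConj_conj_le g).trans (mk_quotient_le.trans ?_)
      rw [mk_freeGroup, max_eq_left (aleph0_le_mk X)]
  set L := Subgroup.normalClosure ({σ} : Set (MulAut (FreeGroup X ⧸ ⁅R, R⁆))) ⊔
    (commutator (FreeGroup X ⧸ ⁅R, R⁆)).map MulAut.conj with hL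
  have hconj : ∀ (θ : MulAut (FreeGroup X ⧸ ⁅R, R⁆)) (g : FreeGroup X ⧸ ⁅R, R⁆),
      θ * MulAut.conj g * θ⁻¹ = MulAut.conj (θ g) := fun θ g => by ext; simp
  have hinner : (MulAut.conj : (FreeGroup X ⧸ ⁅R, R⁆) →* _).range.Normal := by
    refine ⟨?_⟩
    rintro _ ⟨g, rfl⟩ θ
    exact ⟨θ g, (hconj θ g).symm⟩
  have hcomm : ∀ c ∈ commutator (FreeGroup X ⧸ ⁅R, R⁆), MulAut.conj c ∈ L :=
    fun c hc => Subgroup.mem_sup_right ⟨c, hc, rfl⟩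
  obtain ⟨g, hg⟩ := (hsmall σ).1 ha
  refine ⟨⟨g, hg.symm⟩, le_antisymm ?_ ?_, fun Φ => le_antisymm ?_ ?_⟩
  · refine sup_le (Subgroup.normalClosure_le_normal ?_) ?_
    · rw [Set.singleton_subset_iff]
      exact ⟨g, hg⟩
    · rintro _ ⟨c, -, rfl⟩
      exact ⟨c, rfl⟩
  · obtain ⟨y, γ, hσ, -, hγ, hprim⟩ := hb
    have hLn : L.Normal := by
      have hGn : ((commutator (FreeGroup X ⧸ ⁅R, R⁆)).map MulAut.conj).Normal := by
        refine ⟨?_⟩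
        rintro _ ⟨c, hc, rfl⟩ θ
        rw [hconj]
        refine ⟨θ c, ?_, rfl⟩
        have h := Subgroup.mem_map_of_mem θ.toMonoidHom hc
        rwa [(Subgroup.characteristic_iff_map_eq.1 inferInstance) θ] at h
      exact Subgroup.sup_normal _ _
    have hbot : (natHom R).ker ≠ ⊥ := hS.ker_ne_bot fun c hcc hcr =>
      hc _ (hcomm c hcc) ((hsmall _).2 ⟨c, rfl⟩) hcr
    obtain ⟨r, hr, hr1⟩ := (natHom R).ker.bot_or_exists_ne_one.resolve_left hbot
    have hγg : γ = MulAut.conj (y⁻¹ * g) := by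
      rw [map_mul, map_inv, hg, hσ, inv_mul_cancel_left]
    have hk : y⁻¹ * g ∈ (natHom R).ker := hS.mem_ker_of_commute hr hr1 (by
      have h := hγ r hr
      rwa [hγg, MulAut.conj_apply] at h)
    have hker : (natHom R).ker ≤ commutator (FreeGroup X ⧸ ⁅R, R⁆) := by
      rw [ker_natHom]
      refine (Subgroup.map_mono hRF').trans ?_
      rw [commutator_def, Subgroup.map_commutator]
      exact Subgroup.commutator_mono le_top le_top
    have hgL : MulAut.conj g ∈ L := by
      rw [hg]
      exact Subgroup.mem_sup_left (Subgroup.subset_normalClosure rfl)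
    have htop := hS.eq_top_of_primitive (M := L.comap MulAut.conj) hcomm
      (fun θ m hm => by
        rw [Subgroup.mem_comap, ← hconj]
        exact hLn.conj_mem _ hm θ)
      (y := y)
      (by
        have h := L.mul_mem hgL (L.inv_mem (hcomm _ (hker hk)))
        rwa [← map_inv, ← map_mul, mul_inv_rev, inv_inv, mul_inv_cancel_left] at h)
      hprim
    rintro _ ⟨m, rfl⟩
    exact (htop ▸ Subgroup.mem_top m : m ∈ L.comap MulAut.conj)
  · rintro _ ⟨π, hπ, rfl⟩
    exact (hsmall _).1 ((mk_isConj_map_le Φ π).trans ((hsmall π).2 hπ))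
  · intro π hπ
    exact ⟨Φ⁻¹ π, (hsmall _).1 ((mk_isConj_map_le Φ⁻¹ π).trans ((hsmall π).2 hπ)),
      MulAut.apply_inv_self _ Φ π⟩
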